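/- arXiv:2408.02388 — 3 statements merged into one kernel-verified Lean document; each statement's English description precedes it below -/
import Mathlib

section
/- There exists a first-order sentence φ in the language of graphs such that: (i) φ is preserved by embeddings over the class of all finite simple graphs, i.e., whenever a finite graph G embeds into a finite graph H as an induced subgraph and G ⊨ φ, then H ⊨ φ; and (ii) for every n ≥ 7, the graph H_n is a minimal induced model of φ, i.e., H_n ⊨ φ and every proper induced subgraph of H_n fails to satisfy φ. -/
open FirstOrder Language

/-- Satisfaction of a first-order sentence in the language of graphs by a simple graph. -/
def GSat {V : Type} (G : SimpleGraph V) (φ : Language.graph.Sentence) : Prop :=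
  @Sentence.Realize Language.graph V G.structure φ

/-- A sentence is existential if it has the form `∃ x₁ … xₙ θ` with `θ` quantifier-free. -/
def IsExistentialSentence {L : Language} (ψ : L.Sentence) : Prop :=
  ∃ (n : ℕ) (θ : L.BoundedFormula Empty n), θ.IsQF ∧ ψ = θ.exs

/-- Vertex set of `H_n`: `Sum.inl (Sum.inl i)` is `v_{i+1}`, `Sum.inl (Sum.inr j)` is `u_{j+1}`,
`Sum.inr false` is `a`, and `Sum.inr true` is `b` (indices are 0-based). -/
abbrev HVert (n : ℕ) : Type := (Fin n ⊕ Fin n) ⊕ Bool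

def HnRel (n : ℕ) : HVert n → HVert n → Prop
  | Sum.inl (Sum.inl i), Sum.inl (Sum.inr j) => (i : ℕ) ≤ (j : ℕ)
  | Sum.inl (Sum.inl i), Sum.inl (Sum.inl j) => (j : ℕ) = (i : ℕ) + 1
  | Sum.inl (Sum.inr i), Sum.inl (Sum.inr j) => (i : ℕ) < (j : ℕ) ∧ (j : ℕ) ≠ (i : ℕ) + 1
  | Sum.inr false, Sum.inl (Sum.inr i) => 1 ≤ (i : ℕ)
  | Sum.inr true, Sum.inl (Sum.inr i) => n - 2 ≤ (i : ℕ)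
  | Sum.inr false, Sum.inl (Sum.inl i) => (i : ℕ) = 1
  | Sum.inr true, Sum.inl (Sum.inl i) => (i : ℕ) = n - 2
  | _, _ => False

/-- The graph `H_n` from the paper: `v_i u_j` iff `i ≤ j`; `v_i v_j` (`i < j`) iff `j = i + 1`;
`u_i u_j` (`i < j`) iff `j ≠ i + 1`; `a u_i` for `i ≥ 2`; `b u_i` for `i ≥ n - 1`;
`a v_2`; `b v_{n-1}` (stated with 1-based indices). -/
def Hgraph (n : ℕ) : SimpleGraph (HVert n) := SimpleGraph.fromRel (HnRel n)

/-- The seven-vertex graph induced in `H_n` by `a, u₁, u₂, u₃, v₁, v₂, v₃`; the vertices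
`b, uₙ₋₂, uₙ₋₁, uₙ, vₙ₋₂, vₙ₋₁, vₙ` induce an isomorphic copy. -/
def EndGadget {V : Type} (G : SimpleGraph V) (c x₁ x₂ x₃ y₁ y₂ y₃ : V) : Prop :=
  (G.Adj c x₂ ∧ G.Adj c x₃ ∧ G.Adj c y₂ ∧ G.Adj x₁ x₃ ∧ G.Adj y₁ y₂ ∧ G.Adj y₂ y₃ ∧
    G.Adj y₁ x₁ ∧ G.Adj y₁ x₂ ∧ G.Adj y₁ x₃ ∧ G.Adj y₂ x₂ ∧ G.Adj y₂ x₃ ∧ G.Adj y₃ x₃) ∧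
  (¬ G.Adj c x₁ ∧ ¬ G.Adj c y₁ ∧ ¬ G.Adj c y₃ ∧ ¬ G.Adj x₁ x₂ ∧ ¬ G.Adj x₂ x₃ ∧
    ¬ G.Adj y₁ y₃ ∧ ¬ G.Adj y₂ x₁ ∧ ¬ G.Adj y₃ x₁ ∧ ¬ G.Adj y₃ x₂)

section Adjacency

variable {n : ℕ}

@[simp] lemma hgraph_vv (i j : Fin n) : (Hgraph n).Adj (.inl (.inl i)) (.inl (.inl j)) ↔
    (j : ℕ) = i + 1 ∨ (i : ℕ) = j + 1 := by
  simp [Hgraph, HnRel, Fin.ext_iff]; omega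

@[simp] lemma hgraph_uu (i j : Fin n) : (Hgraph n).Adj (.inl (.inr i)) (.inl (.inr j)) ↔
    (i : ℕ) + 1 < j ∨ (j : ℕ) + 1 < i := by
  simp [Hgraph, HnRel, Fin.ext_iff]; omega

@[simp] lemma hgraph_vu (i j : Fin n) : (Hgraph n).Adj (.inl (.inl i)) (.inl (.inr j)) ↔
    (i : ℕ) ≤ j := by
  simp [Hgraph, HnRel]

@[simp] lemma hgraph_uv (i j : Fin n) : (Hgraph n).Adj (.inl (.inr i)) (.inl (.inl j)) ↔
    (j : ℕ) ≤ i := by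
  simp [Hgraph, HnRel]

@[simp] lemma hgraph_av (i : Fin n) : (Hgraph n).Adj (.inr false) (.inl (.inl i)) ↔
    (i : ℕ) = 1 := by
  simp [Hgraph, HnRel]

@[simp] lemma hgraph_va (i : Fin n) : (Hgraph n).Adj (.inl (.inl i)) (.inr false) ↔
    (i : ℕ) = 1 := by
  simp [Hgraph, HnRel]

@[simp] lemma hgraph_au (i : Fin n) : (Hgraph n).Adj (.inr false) (.inl (.inr i)) ↔
    1 ≤ (i : ℕ) := by
  simp [Hgraph, HnRel]

@[simp] lemma hgraph_ua (i : Fin n) : (Hgraph n).Adj (.inl (.inr i)) (.inr false) ↔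
    1 ≤ (i : ℕ) := by
  simp [Hgraph, HnRel]

@[simp] lemma hgraph_bv (i : Fin n) : (Hgraph n).Adj (.inr true) (.inl (.inl i)) ↔
    (i : ℕ) = n - 2 := by
  simp [Hgraph, HnRel]

@[simp] lemma hgraph_vb (i : Fin n) : (Hgraph n).Adj (.inl (.inl i)) (.inr true) ↔
    (i : ℕ) = n - 2 := by
  simp [Hgraph, HnRel]

@[simp] lemma hgraph_bu (i : Fin n) : (Hgraph n).Adj (.inr true) (.inl (.inr i)) ↔
    n - 2 ≤ (i : ℕ) := by
  simp [Hgraph, HnRel]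

@[simp] lemma hgraph_ub (i : Fin n) : (Hgraph n).Adj (.inl (.inr i)) (.inr true) ↔
    n - 2 ≤ (i : ℕ) := by
  simp [Hgraph, HnRel]

@[simp] lemma hgraph_inr_inr (s t : Bool) : ¬ (Hgraph n).Adj (.inr s) (.inr t) := by
  cases s <;> cases t <;> simp [Hgraph, HnRel]

end Adjacency

set_option maxHeartbeats 2000000 in
lemma EndGadget.hgraph_cases {n : ℕ} (hn : 7 ≤ n) {c x₁ x₂ x₃ y₁ y₂ y₃ : HVert n}
    (h : EndGadget (Hgraph n) c x₁ x₂ x₃ y₁ y₂ y₃) :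
    (c = .inr false ∧ x₁ = .inl (.inr ⟨0, by omega⟩) ∧ x₂ = .inl (.inr ⟨1, by omega⟩) ∧
      x₃ = .inl (.inr ⟨2, by omega⟩) ∧ y₁ = .inl (.inl ⟨0, by omega⟩) ∧
      y₂ = .inl (.inl ⟨1, by omega⟩) ∧ y₃ = .inl (.inl ⟨2, by omega⟩)) ∨
    (c = .inr true ∧ x₁ = .inl (.inr ⟨n - 3, by omega⟩) ∧
      x₂ = .inl (.inr ⟨n - 2, by omega⟩) ∧ x₃ = .inl (.inr ⟨n - 1, by omega⟩) ∧
      y₁ = .inl (.inl ⟨n - 3, by omega⟩) ∧ y₂ = .inl (.inl ⟨n - 2, by omega⟩) ∧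
      y₃ = .inl (.inl ⟨n - 1, by omega⟩)) := by
  obtain ⟨⟨h₁, h₂, h₃, h₄, h₅, h₆, h₇, h₈, h₉, h₁₀, h₁₁, h₁₂⟩,
    k₁, k₂, k₃, k₄, k₅, k₆, k₇, k₈, k₉⟩ := h
  have d₁ : x₂ ≠ x₃ := by rintro rfl; exact k₉ h₁₂
  have d₂ : x₁ ≠ x₂ := by rintro rfl; exact k₇ h₁₀
  have d₄ : y₁ ≠ y₃ := by rintro rfl; exact k₈ h₇
  rcases c with (c | c) | (_ | _) <;> rcases x₂ with (x₂ | x₂) | (_ | _) <;>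
  simp at h₁ <;>
  rcases x₃ with (x₃ | x₃) | (_ | _) <;>
  simp [Fin.ext_iff] at h₂ k₅ d₁ <;> (try omega) <;>
  rcases y₁ with (y₁ | y₁) | (_ | _) <;>
  simp at h₈ h₉ k₂ <;> (try omega) <;>
  rcases x₁ with (x₁ | x₁) | (_ | _) <;>
  simp [Fin.ext_iff] at h₄ h₇ k₁ k₄ d₂ <;> (try omega) <;>
  rcases y₂ with (y₂ | y₂) | (_ | _) <;>
  simp at h₃ h₅ h₁₀ h₁₁ k₇ <;> (try omega) <;>
  rcases y₃ with (y₃ | y₃) | (_ | _) <;>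
  simp [Fin.ext_iff] at h₆ h₁₂ k₃ k₆ k₈ k₉ d₄ ⊢ <;> omega
/-- The class of graphs with `k` marked vertices satisfying `P` is first-order definable. -/
def GraphDefinable (k : ℕ) (P : ∀ V : Type, SimpleGraph V → (Fin k → V) → Prop) : Prop :=
  ∃ ψ : Language.graph.BoundedFormula Empty k, ∀ (V : Type) (G : SimpleGraph V) (xs : Fin k → V),
    (letI := G.structure; ψ.Realize default xs) ↔ P V G xs

namespace GraphDefinable

variable {k : ℕ} {P Q : ∀ V : Type, SimpleGraph V → (Fin k → V) → Prop}

lemma adj (i j : Fin k) : GraphDefinable k fun _ G xs => G.Adj (xs i) (xs j) :=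
  ⟨Language.adj.boundedFormula₂ (Term.var (.inr i)) (Term.var (.inr j)), fun V G xs => by
    let := G.structure
    simp only [BoundedFormula.realize_rel₂]
    rfl⟩

lemma eq (i j : Fin k) : GraphDefinable k fun _ _ xs => xs i = xs j :=
  ⟨(Term.var (.inr i)).bdEqual (Term.var (.inr j)), fun V G xs => by
    let := G.structure
    simp⟩

lemma not (hP : GraphDefinable k P) : GraphDefinable k fun V G xs => ¬ P V G xs := by
  obtain ⟨ψ, hψ⟩ := hP
  exact ⟨ψ.not, fun V G xs => by simp [← hψ]⟩

lemma and (hP : GraphDefinable k P) (hQ : GraphDefinable k Q) :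
    GraphDefinable k fun V G xs => P V G xs ∧ Q V G xs := by
  obtain ⟨ψ, hψ⟩ := hP
  obtain ⟨χ, hχ⟩ := hQ
  exact ⟨ψ ⊓ χ, fun V G xs => by simp [← hψ, ← hχ]⟩

lemma or (hP : GraphDefinable k P) (hQ : GraphDefinable k Q) :
    GraphDefinable k fun V G xs => P V G xs ∨ Q V G xs := by
  obtain ⟨ψ, hψ⟩ := hP
  obtain ⟨χ, hχ⟩ := hQ
  exact ⟨ψ ⊔ χ, fun V G xs => by simp [← hψ, ← hχ]⟩

lemma imp (hP : GraphDefinable k P) (hQ : GraphDefinable k Q) :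
    GraphDefinable k fun V G xs => P V G xs → Q V G xs := by
  obtain ⟨ψ, hψ⟩ := hP
  obtain ⟨χ, hχ⟩ := hQ
  exact ⟨ψ.imp χ, fun V G xs => by simp [← hψ, ← hχ]⟩

lemma all {R : ∀ V : Type, SimpleGraph V → (Fin k → V) → V → Prop}
    (hR : GraphDefinable (k + 1) fun V G ys =>
      R V G (fun i => ys i.castSucc) (ys (Fin.last k))) :
    GraphDefinable k fun V G xs => ∀ x, R V G xs x := by
  obtain ⟨ψ, hψ⟩ := hR
  exact ⟨ψ.all, fun V G xs => by simp [hψ]⟩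

lemma ex {R : ∀ V : Type, SimpleGraph V → (Fin k → V) → V → Prop}
    (hR : GraphDefinable (k + 1) fun V G ys =>
      R V G (fun i => ys i.castSucc) (ys (Fin.last k))) :
    GraphDefinable k fun V G xs => ∃ x, R V G xs x := by
  obtain ⟨ψ, hψ⟩ := hR
  exact ⟨ψ.ex, fun V G xs => by simp [hψ]⟩

lemma exists_sentence (hP : GraphDefinable k P) :
    ∃ φ : Language.graph.Sentence, ∀ (V : Type) (G : SimpleGraph V),
      GSat G φ ↔ ∃ xs, P V G xs := by
  obtain ⟨ψ, hψ⟩ := hP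
  refine ⟨ψ.exs, fun V G => ?_⟩
  let := G.structure
  simp only [GSat, Sentence.Realize, BoundedFormula.realize_exs, ← hψ]

end GraphDefinable

/-- The properties below concern a graph with fourteen marked vertices, which in `H_n` stand for
`a, u₁, u₂, u₃, v₁, v₂, v₃, b, uₙ₋₂, uₙ₋₁, uₙ, vₙ₋₂, vₙ₋₁, vₙ`. This one singles out the vertices
that play the role of some `uᵢ`. -/
def IsU {V : Type} (G : SimpleGraph V) (p : Fin 14 → V) (x : V) : Prop :=
  G.Adj x (p 4) ∧ ¬ x = p 5

/-- The vertices that play the role of some `vᵢ`. -/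
def IsV {V : Type} (G : SimpleGraph V) (p : Fin 14 → V) (x : V) : Prop :=
  G.Adj x (p 10) ∧ (¬ G.Adj x (p 4) ∨ x = p 5) ∧ ¬ x = p 0 ∧ ¬ x = p 7

/-- The marked vertices form two correctly placed end gadgets. -/
def IsFrame {V : Type} (G : SimpleGraph V) (p : Fin 14 → V) : Prop :=
  EndGadget G (p 0) (p 1) (p 2) (p 3) (p 4) (p 5) (p 6) ∧
  EndGadget G (p 7) (p 8) (p 9) (p 10) (p 11) (p 12) (p 13) ∧
  G.Adj (p 6) (p 8) ∧ IsU G p (p 10) ∧ IsV G p (p 4)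

/-- Four vertices violating the half-graph structure between the `vᵢ` and the `uᵢ`. -/
def BadQuadruple {V : Type} (G : SimpleGraph V) (x y u w : V) : Prop :=
  (G.Adj x u ∧ ¬ G.Adj y u ∧ ¬ G.Adj x w ∧ G.Adj y w) ∨
  (¬ x = y ∧ ¬ u = w ∧ ¬ G.Adj u w ∧ G.Adj x u ∧ G.Adj y u ∧ ¬ G.Adj x w ∧ ¬ G.Adj y w) ∨
  (¬ u = w ∧ G.Adj x y ∧ G.Adj x u ∧ G.Adj x w ∧ ¬ G.Adj y u ∧ ¬ G.Adj y w)

/-- Some universal property of the standard marking of `H_n` fails. -/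
def HasViolation {V : Type} (G : SimpleGraph V) (p : Fin 14 → V) : Prop :=
  (∃ x y u w, IsV G p x ∧ IsV G p y ∧ IsU G p u ∧ IsU G p w ∧ BadQuadruple G x y u w) ∨
  (∃ x, IsV G p x ∧ G.Adj x (p 1) ∧ ¬ x = p 4) ∨
  (∃ u, IsU G p u ∧ G.Adj u (p 13) ∧ ¬ u = p 10)

/-- Every `vᵢ` other than the last has a successor, and every `uᵢ` other than the first has a
predecessor. -/
def HasFullChain {V : Type} (G : SimpleGraph V) (p : Fin 14 → V) : Prop :=
  (∀ x, IsV G p x → ¬ x = p 13 → ∃ y, IsV G p y ∧ G.Adj x y ∧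
    ∃ u, IsU G p u ∧ G.Adj x u ∧ ¬ G.Adj y u) ∧
  (∀ u, IsU G p u → ¬ u = p 1 → ∃ w, IsU G p w ∧ ¬ u = w ∧ ¬ G.Adj u w ∧
    ∃ y, IsV G p y ∧ G.Adj y u ∧ ¬ G.Adj y w)

lemma graphDefinable_frame :
    GraphDefinable 14 fun _ G p => IsFrame G p ∧ (HasViolation G p ∨ HasFullChain G p) := by
  unfold IsFrame HasViolation HasFullChain BadQuadruple IsU IsV EndGadget
  repeat' first
    | apply GraphDefinable.adj
    | apply GraphDefinable.eq
    | apply GraphDefinable.and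
    | apply GraphDefinable.or
    | apply GraphDefinable.not
    | apply GraphDefinable.ex
    | apply GraphDefinable.all
    | apply GraphDefinable.imp

section Embedding

variable {V W : Type} {G : SimpleGraph V} {H : SimpleGraph W} (f : G ↪g H) {p : Fin 14 → V}

lemma isU_map_iff {x : V} : IsU H (f ∘ p) (f x) ↔ IsU G p x := by
  simp [IsU]

lemma isV_map_iff {x : V} : IsV H (f ∘ p) (f x) ↔ IsV G p x := by
  simp [IsV]

lemma isFrame_map_iff : IsFrame H (f ∘ p) ↔ IsFrame G p := by
  have hU := isU_map_iff f (p := p) (x := p 10)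
  have hV := isV_map_iff f (p := p) (x := p 4)
  simp only [IsFrame, EndGadget, Function.comp_apply, f.map_adj_iff, hU, hV]

lemma HasViolation.map (h : HasViolation G p) : HasViolation H (f ∘ p) := by
  rcases h with ⟨x, y, u, w, hx, hy, hu, hw, h⟩ | ⟨x, hx, h, h'⟩ | ⟨u, hu, h, h'⟩
  · refine .inl ⟨f x, f y, f u, f w, (isV_map_iff f).2 hx, (isV_map_iff f).2 hy,
      (isU_map_iff f).2 hu, (isU_map_iff f).2 hw, ?_⟩
    simpa only [BadQuadruple, f.map_adj_iff, f.injective.eq_iff] using h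
  · exact .inr (.inl ⟨f x, (isV_map_iff f).2 hx, f.map_adj_iff.2 h, fun e => h' (f.injective e)⟩)
  · exact .inr (.inr ⟨f u, (isU_map_iff f).2 hu, f.map_adj_iff.2 h, fun e => h' (f.injective e)⟩)

/-- Adjacency between the `vᵢ` and the `uᵢ` is monotone when there is no violation. -/
lemma adj_of_not_hasViolation (h : ¬ HasViolation G p) {x y u w : V} (hx : IsV G p x)
    (hy : IsV G p y) (hu : IsU G p u) (hw : IsU G p w) (hxu : G.Adj x u) (hyu : ¬ G.Adj y u)
    (hyw : G.Adj y w) : G.Adj x w := by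
  by_contra hxw
  exact h (.inl ⟨x, y, u, w, hx, hy, hu, hw, .inl ⟨hxu, hyu, hxw, hyw⟩⟩)

lemma exists_of_isU [Finite V] (hF : IsFrame G p) (hT : HasFullChain G p)
    (hH : ¬ HasViolation H (f ∘ p)) {w : W} (hw : IsU H (f ∘ p) w) :
    ∃ u, IsU G p u ∧ f u = w := by
  have hG : ¬ HasViolation G p := fun h => hH (h.map f)
  obtain ⟨x, ⟨hx, hwx⟩, hmin⟩ := Set.exists_min_image {x | IsV G p x ∧ H.Adj w (f x)}
    (fun x => {u | IsU G p u ∧ G.Adj x u}.ncard) (Set.toFinite _) ⟨p 4, hF.2.2.2.2, hw.1⟩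
  by_cases hlast : x = p 13
  · subst hlast
    refine ⟨p 10, hF.2.2.2.1, ?_⟩
    by_contra hne
    exact hH (.inr (.inr ⟨w, hw, hwx, fun e => hne e.symm⟩))
  obtain ⟨y, hy, hxy, u, hu, hxu, hyu⟩ := hT.1 x hx hlast
  have hlt : {u | IsU G p u ∧ G.Adj y u}.ncard < {u | IsU G p u ∧ G.Adj x u}.ncard :=
    Set.ncard_lt_ncard (Set.ssubset_iff_exists.2 ⟨fun z hz =>
      ⟨hz.1, adj_of_not_hasViolation hG hx hy hu hz.1 hxu hyu hz.2⟩,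
        u, ⟨hu, hxu⟩, fun h => hyu h.2⟩) (Set.toFinite _)
  have hwy : ¬ H.Adj w (f y) := fun h => (hmin y ⟨hy, h⟩).not_gt hlt
  refine ⟨u, hu, ?_⟩
  by_contra hne
  exact hH (.inl ⟨f x, f y, f u, w, (isV_map_iff f).2 hx, (isV_map_iff f).2 hy,
    (isU_map_iff f).2 hu, hw, .inr (.inr ⟨hne, f.map_adj_iff.2 hxy, f.map_adj_iff.2 hxu, hwx.symm,
      fun h => hyu (f.map_adj_iff.1 h), fun h => hwy h.symm⟩)⟩)

lemma exists_of_isV [Finite V] (hF : IsFrame G p) (hT : HasFullChain G p)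
    (hH : ¬ HasViolation H (f ∘ p)) {x : W} (hx : IsV H (f ∘ p) x) :
    ∃ y, IsV G p y ∧ f y = x := by
  have hG : ¬ HasViolation G p := fun h => hH (h.map f)
  obtain ⟨u, ⟨hu, hxu⟩, hmin⟩ := Set.exists_min_image {u | IsU G p u ∧ H.Adj x (f u)}
    (fun u => {y | IsV G p y ∧ G.Adj y u}.ncard) (Set.toFinite _) ⟨p 10, hF.2.2.2.1, hx.1⟩
  by_cases hfirst : u = p 1
  · subst hfirst
    refine ⟨p 4, hF.2.2.2.2, ?_⟩
    by_contra hne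
    exact hH (.inr (.inl ⟨x, hx, hxu, fun e => hne e.symm⟩))
  obtain ⟨w, hw, huw, hnuw, y, hy, hyu, hyw⟩ := hT.2 u hu hfirst
  have hlt : {y | IsV G p y ∧ G.Adj y w}.ncard < {y | IsV G p y ∧ G.Adj y u}.ncard :=
    Set.ncard_lt_ncard (Set.ssubset_iff_exists.2 ⟨fun z hz => ⟨hz.1, by
      by_contra hzu
      exact hyw (adj_of_not_hasViolation hG hy hz.1 hu hw hyu hzu hz.2)⟩,
        y, ⟨hy, hyu⟩, fun h => hyw h.2⟩) (Set.toFinite _)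
  have hxw : ¬ H.Adj x (f w) := fun h => (hmin w ⟨hw, h⟩).not_gt hlt
  refine ⟨y, hy, ?_⟩
  by_contra hne
  exact hH (.inl ⟨f y, x, f u, f w, (isV_map_iff f).2 hy, hx, (isU_map_iff f).2 hu,
    (isU_map_iff f).2 hw, .inr (.inl ⟨hne, fun e => huw (f.injective e),
      fun h => hnuw (f.map_adj_iff.1 h), f.map_adj_iff.2 hyu, hxu,
      fun h => hyw (f.map_adj_iff.1 h), hxw⟩)⟩)

lemma HasFullChain.map [Finite V] (hF : IsFrame G p) (hT : HasFullChain G p)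
    (hH : ¬ HasViolation H (f ∘ p)) : HasFullChain H (f ∘ p) := by
  constructor
  · intro x hx hne
    obtain ⟨x, hx', rfl⟩ := exists_of_isV f hF hT hH hx
    obtain ⟨y, hy, hxy, u, hu, hxu, hyu⟩ := hT.1 x hx' fun e => hne (congrArg f e)
    exact ⟨f y, (isV_map_iff f).2 hy, f.map_adj_iff.2 hxy, f u, (isU_map_iff f).2 hu,
      f.map_adj_iff.2 hxu, fun h => hyu (f.map_adj_iff.1 h)⟩
  · intro u hu hne
    obtain ⟨u, hu', rfl⟩ := exists_of_isU f hF hT hH hu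
    obtain ⟨w, hw, huw, hnuw, y, hy, hyu, hyw⟩ := hT.2 u hu' fun e => hne (congrArg f e)
    exact ⟨f w, (isU_map_iff f).2 hw, fun e => huw (f.injective e),
      fun h => hnuw (f.map_adj_iff.1 h), f y, (isV_map_iff f).2 hy, f.map_adj_iff.2 hyu,
      fun h => hyw (f.map_adj_iff.1 h)⟩

end Embedding

section Standard

variable {n : ℕ}

/-- The standard marking of `H_n`. -/
def stdMarking (hn : 7 ≤ n) : Fin 14 → HVert n :=
  ![.inr false, .inl (.inr ⟨0, by omega⟩), .inl (.inr ⟨1, by omega⟩), .inl (.inr ⟨2, by omega⟩),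
    .inl (.inl ⟨0, by omega⟩), .inl (.inl ⟨1, by omega⟩), .inl (.inl ⟨2, by omega⟩),
    .inr true, .inl (.inr ⟨n - 3, by omega⟩), .inl (.inr ⟨n - 2, by omega⟩),
    .inl (.inr ⟨n - 1, by omega⟩), .inl (.inl ⟨n - 3, by omega⟩), .inl (.inl ⟨n - 2, by omega⟩),
    .inl (.inl ⟨n - 1, by omega⟩)]

lemma isU_stdMarking_iff (hn : 7 ≤ n) {x : HVert n} :
    IsU (Hgraph n) (stdMarking hn) x ↔ ∃ i, x = .inl (.inr i) := by
  rcases x with (i | i) | (_ | _) <;> simp [IsU, stdMarking, Fin.ext_iff]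
  omega

lemma isV_stdMarking_iff (hn : 7 ≤ n) {x : HVert n} :
    IsV (Hgraph n) (stdMarking hn) x ↔ ∃ i, x = .inl (.inl i) := by
  rcases x with (i | i) | (_ | _) <;> simp [IsV, stdMarking, Fin.ext_iff]
  omega

lemma isFrame_stdMarking (hn : 7 ≤ n) : IsFrame (Hgraph n) (stdMarking hn) := by
  refine ⟨?_, ?_, ?_, (isU_stdMarking_iff hn).2 ⟨_, rfl⟩, (isV_stdMarking_iff hn).2 ⟨_, rfl⟩⟩ <;>
    simp [EndGadget, stdMarking] <;> omega

lemma IsFrame.eq_stdMarking (hn : 7 ≤ n) {p : Fin 14 → HVert n} (h : IsFrame (Hgraph n) p) :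
    p = stdMarking hn := by
  obtain ⟨hL, hR, hadj, -⟩ := h
  rcases hL.hgraph_cases hn with ⟨e₀, e₁, e₂, e₃, e₄, e₅, e₆⟩ | ⟨e₀, e₁, e₂, e₃, e₄, e₅, e₆⟩ <;>
  rcases hR.hgraph_cases hn with ⟨e₇, e₈, e₉, e₁₀, e₁₁, e₁₂, e₁₃⟩ | ⟨e₇, e₈, e₉, e₁₀, e₁₁, e₁₂, e₁₃⟩
  on_goal 2 => funext i; fin_cases i <;> assumption
  all_goals rw [e₆, e₈, hgraph_vu] at hadj; simp at hadj
  all_goals omega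

lemma not_hasViolation_stdMarking (hn : 7 ≤ n) : ¬ HasViolation (Hgraph n) (stdMarking hn) := by
  rintro (⟨x, y, u, w, hx, hy, hu, hw, h⟩ | ⟨x, hx, h, h'⟩ | ⟨u, hu, h, h'⟩)
  · obtain ⟨x, rfl⟩ := (isV_stdMarking_iff hn).1 hx
    obtain ⟨y, rfl⟩ := (isV_stdMarking_iff hn).1 hy
    obtain ⟨u, rfl⟩ := (isU_stdMarking_iff hn).1 hu
    obtain ⟨w, rfl⟩ := (isU_stdMarking_iff hn).1 hw
    simp [BadQuadruple, Fin.ext_iff] at h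
    omega
  · obtain ⟨x, rfl⟩ := (isV_stdMarking_iff hn).1 hx
    simp [stdMarking, Fin.ext_iff] at h h'
    omega
  · obtain ⟨u, rfl⟩ := (isU_stdMarking_iff hn).1 hu
    simp [stdMarking, Fin.ext_iff] at h h'
    omega

lemma hasFullChain_stdMarking (hn : 7 ≤ n) : HasFullChain (Hgraph n) (stdMarking hn) := by
  constructor
  · intro x hx hne
    obtain ⟨i, rfl⟩ := (isV_stdMarking_iff hn).1 hx
    have hi : (i : ℕ) + 1 < n := by
      simp [stdMarking, Fin.ext_iff] at hne
      omega
    exact ⟨.inl (.inl ⟨i + 1, hi⟩), (isV_stdMarking_iff hn).2 ⟨_, rfl⟩, by simp,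
      .inl (.inr i), (isU_stdMarking_iff hn).2 ⟨_, rfl⟩, by simp, by simp⟩
  · intro u hu hne
    obtain ⟨i, rfl⟩ := (isU_stdMarking_iff hn).1 hu
    have hi : 0 < (i : ℕ) := by
      simp [stdMarking, Fin.ext_iff] at hne
      omega
    refine ⟨.inl (.inr ⟨i - 1, by omega⟩), (isU_stdMarking_iff hn).2 ⟨_, rfl⟩, ?_, ?_,
      .inl (.inl i), (isV_stdMarking_iff hn).2 ⟨_, rfl⟩, ?_, ?_⟩ <;> simp [Fin.ext_iff] <;> omega

lemma eq_univ_of_hasFullChain_induce (hn : 7 ≤ n) {S : Set (HVert n)} {p : Fin 14 → S}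
    (hp : Subtype.val ∘ p = stdMarking hn) (hT : HasFullChain ((Hgraph n).induce S) p) :
    S = Set.univ := by
  let f : (Hgraph n).induce S ↪g Hgraph n := SimpleGraph.Embedding.induce S
  have hf : f ∘ p = stdMarking hn := hp
  have hmem (i : Fin 14) : stdMarking hn i ∈ S := hp ▸ (p i).2
  have hstep (i : ℕ) (hi : i + 1 < n) (h : .inl (.inl ⟨i, by omega⟩) ∈ S) :
      .inl (.inl ⟨i + 1, hi⟩) ∈ S ∧ .inl (.inr ⟨i, by omega⟩) ∈ S := by
    have hV : IsV ((Hgraph n).induce S) p ⟨_, h⟩ := by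
      rw [← isV_map_iff f, hf, isV_stdMarking_iff]
      exact ⟨_, rfl⟩
    obtain ⟨y, hy, hxy, u, hu, hxu, hyu⟩ := hT.1 _ hV fun e => by
      have := (congrArg Subtype.val e).trans (congrFun hp 13)
      simp [stdMarking, Fin.ext_iff] at this
      omega
    rw [← isV_map_iff f, hf, isV_stdMarking_iff] at hy
    rw [← isU_map_iff f, hf, isU_stdMarking_iff] at hu
    obtain ⟨⟨y, hyS⟩, u, huS⟩ := y, u
    obtain ⟨j, rfl⟩ : ∃ j, y = .inl (.inl j) := hy
    obtain ⟨k, rfl⟩ : ∃ k, u = .inl (.inr k) := hu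
    simp at hxy hxu hyu
    have hj : j = ⟨i + 1, hi⟩ := by ext; simp; omega
    have hk : k = ⟨i, by omega⟩ := by ext; simp; omega
    exact ⟨hj ▸ hyS, hk ▸ huS⟩
  have hv (i : ℕ) (hi : i < n) : .inl (.inl ⟨i, hi⟩) ∈ S := by
    induction i with
    | zero => exact hmem 4
    | succ i ih => exact (hstep i hi (ih (by omega))).1
  refine Set.eq_univ_of_forall fun x => ?_
  rcases x with (i | ⟨i, hi⟩) | (_ | _)
  · exact hv i i.2
  · rcases Nat.lt_or_ge (i + 1) n with h | h
    · exact (hstep i h (hv i hi)).2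
    · obtain rfl : i = n - 1 := by omega
      exact hmem 10
  · exact hmem 0
  · exact hmem 7

end Standard

/-- There is a first-order graph sentence `φ` preserved by embeddings over the class of all
finite simple graphs such that, for every `n ≥ 7`, the graph `H_n` is a minimal induced model
of `φ`. -/
theorem stmt_2 :
    ∃ φ : Language.graph.Sentence,
      (∀ (V W : Type) [Fintype V] [Fintype W] (G : SimpleGraph V) (H : SimpleGraph W),
        (G ↪g H) → GSat G φ → GSat H φ) ∧
      (∀ n : ℕ, 7 ≤ n →
        GSat (Hgraph n) φ ∧
        ∀ S : Set (HVert n), S ≠ Set.univ → ¬ GSat ((Hgraph n).induce S) φ) := by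
  obtain ⟨φ, hφ⟩ := graphDefinable_frame.exists_sentence
  refine ⟨φ, fun V W _ _ G H f hG => ?_, fun n hn => ⟨?_, fun S hS hSφ => hS ?_⟩⟩
  · obtain ⟨p, hF, h⟩ := (hφ V G).1 hG
    refine (hφ W H).2 ⟨f ∘ p, (isFrame_map_iff f).2 hF, ?_⟩
    by_cases hH : HasViolation H (f ∘ p)
    · exact .inl hH
    · exact .inr ((h.resolve_left fun h => hH (h.map f)).map f hF hH)
  · exact (hφ _ _).2 ⟨_, isFrame_stdMarking hn, .inr (hasFullChain_stdMarking hn)⟩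
  · obtain ⟨p, hF, h⟩ := (hφ _ _).1 hSφ
    let f : (Hgraph n).induce S ↪g Hgraph n := SimpleGraph.Embedding.induce S
    have hp : f ∘ p = stdMarking hn := ((isFrame_map_iff f).2 hF).eq_stdMarking hn
    exact eq_univ_of_hasFullChain_induce hn hp
      (h.resolve_left fun h => not_hasViolation_stdMarking hn (hp ▸ h.map f))
end

section
/- Let C be a hereditary class of finite simple graphs, closed under isomorphism, that contains the graphs H_n for arbitrarily large n (i.e., for every N there is n ≥ N with H_n ∈ C). Then extension preservation fails on C: there exists a first-order sentence in the language of graphs that is preserved by embeddings over C but is not equivalent over C to any existential sentence. -/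
open FirstOrder Language

/-- Two tuples of vertices, possibly in different graphs, have the same quantifier-free type. -/
def SamePat {α V W : Type} (G : SimpleGraph V) (x : α → V) (H : SimpleGraph W) (y : α → W) :
    Prop :=
  ∀ i j, (x i = x j ↔ y i = y j) ∧ (G.Adj (x i) (x j) ↔ H.Adj (y i) (y j))

namespace SamePat

variable {α β V W U : Type} {G : SimpleGraph V} {H : SimpleGraph W} {K : SimpleGraph U}
  {x : α → V} {y : α → W} {z : α → U}

theorem eq_iff (h : SamePat G x H y) (i j : α) : x i = x j ↔ y i = y j := (h i j).1

theorem adj_iff (h : SamePat G x H y) (i j : α) : G.Adj (x i) (x j) ↔ H.Adj (y i) (y j) :=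
  (h i j).2

theorem symm (h : SamePat G x H y) : SamePat H y G x :=
  fun i j => ⟨(h i j).1.symm, (h i j).2.symm⟩

theorem trans (h : SamePat G x H y) (h' : SamePat H y K z) : SamePat G x K z :=
  fun i j => ⟨(h i j).1.trans (h' i j).1, (h i j).2.trans (h' i j).2⟩

theorem comp (h : SamePat G x H y) (f : β → α) : SamePat G (x ∘ f) H (y ∘ f) :=
  fun i j => h (f i) (f j)

theorem of_embedding (f : G ↪g H) (x : α → V) : SamePat G x H (f ∘ x) :=
  fun i j => ⟨by simp, by simp⟩

end SamePat

/-- A property of tuples in graphs is definable if some first-order formula defines it in all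
graphs. -/
def GDef {α : Type} (P : ∀ V : Type, SimpleGraph V → (α → V) → Prop) : Prop :=
  ∃ φ : Language.graph.Formula α, ∀ (V : Type) (G : SimpleGraph V) (x : α → V),
    @Formula.Realize Language.graph V G.structure α φ x ↔ P V G x

namespace GDef

variable {α β : Type} {P Q : ∀ V : Type, SimpleGraph V → (α → V) → Prop}

theorem not (h : GDef P) : GDef fun V G x => ¬ P V G x := by
  obtain ⟨φ, hφ⟩ := h
  refine ⟨φ.not, fun V G x => ?_⟩
  let := G.structure
  simp only [Formula.realize_not, ← hφ]

theorem and (h : GDef P) (h' : GDef Q) : GDef fun V G x => P V G x ∧ Q V G x := by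
  obtain ⟨φ, hφ⟩ := h
  obtain ⟨ψ, hψ⟩ := h'
  refine ⟨φ ⊓ ψ, fun V G x => ?_⟩
  let := G.structure
  simp only [Formula.realize_inf, ← hφ, ← hψ]

theorem or (h : GDef P) (h' : GDef Q) : GDef fun V G x => P V G x ∨ Q V G x := by
  obtain ⟨φ, hφ⟩ := h
  obtain ⟨ψ, hψ⟩ := h'
  refine ⟨φ ⊔ ψ, fun V G x => ?_⟩
  let := G.structure
  simp only [Formula.realize_sup, ← hφ, ← hψ]

theorem ex [Finite β] {P : ∀ V : Type, SimpleGraph V → (α ⊕ β → V) → Prop} (h : GDef P) :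
    GDef fun V G x => ∃ y : β → V, P V G (Sum.elim x y) := by
  obtain ⟨φ, hφ⟩ := h
  refine ⟨φ.iExs β, fun V G x => ?_⟩
  let := G.structure
  rw [Formula.realize_iExs]
  simp only [← hφ]

theorem all [Finite β] {P : ∀ V : Type, SimpleGraph V → (α ⊕ β → V) → Prop} (h : GDef P) :
    GDef fun V G x => ∀ y : β → V, P V G (Sum.elim x y) := by
  obtain ⟨φ, hφ⟩ := h
  refine ⟨φ.iAlls β, fun V G x => ?_⟩
  let := G.structure
  rw [Formula.realize_iAlls]
  simp only [← hφ]

/-- A property of finite tuples that depends only on their quantifier-free type is definable. -/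
theorem of_samePat [Finite α]
    (h : ∀ (V W : Type) (G : SimpleGraph V) (H : SimpleGraph W) (x : α → V) (y : α → W),
      SamePat G x H y → P V G x → P W H y) : GDef P := by
  classical
  let I := {p : (α → α → Prop) × (α → α → Prop) // ∃ (V : Type) (G : SimpleGraph V) (x : α → V),
    P V G x ∧ ∀ i j, (x i = x j ↔ p.1 i j) ∧ (G.Adj (x i) (x j) ↔ p.2 i j)}
  let e : α → α → Language.graph.Formula α := fun i j => (Term.var i).equal (Term.var j)
  let a : α → α → Language.graph.Formula α := fun i j => adj.formula₂ (Term.var i) (Term.var j)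
  refine ⟨Formula.iSup fun p : I => Formula.iInf fun ij : α × α =>
    (if p.1.1 ij.1 ij.2 then e ij.1 ij.2 else (e ij.1 ij.2).not) ⊓
    (if p.1.2 ij.1 ij.2 then a ij.1 ij.2 else (a ij.1 ij.2).not), fun V G x => ?_⟩
  let := G.structure
  have he : ∀ i j, (e i j).Realize x ↔ x i = x j := fun i j => by
    simp [e, Formula.realize_equal]
  have ha : ∀ i j, (a i j).Realize x ↔ G.Adj (x i) (x j) := fun i j => by
    simp only [a, Formula.realize_rel₂, Term.realize_var]
    rfl
  have hif : ∀ (q : Prop) (φ : Language.graph.Formula α),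
      (if q then φ else φ.not).Realize x ↔ (φ.Realize x ↔ q) := by
    intro q φ
    by_cases hq : q <;> simp [hq, Formula.realize_not]
  simp only [Formula.realize_iSup, Formula.realize_iInf, Formula.realize_inf, hif, he, ha]
  constructor
  · rintro ⟨⟨p, W, H, y, hy, hp⟩, hx⟩
    refine h W V H G y x (fun i j => ?_) hy
    exact ⟨(hp i j).1.trans (hx (i, j)).1.symm, (hp i j).2.trans (hx (i, j)).2.symm⟩
  · intro hx
    exact ⟨⟨(fun i j => x i = x j, fun i j => G.Adj (x i) (x j)), V, G, x, hx, by simp⟩, by simp⟩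

end GDef

/-- A graph embedding is an embedding of structures in the language of graphs. -/
def graphStructureEmbedding {V W : Type} {G : SimpleGraph V} {H : SimpleGraph W} (f : G ↪g H) :
    @Language.Embedding Language.graph V W G.structure H.structure :=
  let := G.structure
  let := H.structure
  { toEmbedding := f.toEmbedding
    map_fun' := fun {_} g => isEmptyElim g
    map_rel' := fun {n} r x => by
      match n, r with
      | 2, .adj => exact f.map_rel_iff }

/-- A true existential sentence has boundedly many witnesses, and it holds in every induced
subgraph containing them. -/
theorem IsExistentialSentence.exists_witnesses {ψ : Language.graph.Sentence}
    (hψ : IsExistentialSentence ψ) :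
    ∃ k : ℕ, ∀ (V : Type) (G : SimpleGraph V), GSat G ψ →
      ∃ w : Fin k → V, ∀ S : Set V, (∀ i, w i ∈ S) → GSat (G.induce S) ψ := by
  obtain ⟨k, θ, hθ, rfl⟩ := hψ
  refine ⟨k, fun V G h => ?_⟩
  let := G.structure
  obtain ⟨w, hw⟩ := BoundedFormula.realize_exs.1 h
  refine ⟨w, fun S hS => ?_⟩
  let := (G.induce S).structure
  refine BoundedFormula.realize_exs.2 ⟨fun i => ⟨w i, hS i⟩, ?_⟩
  rw [← hθ.realize_embedding (graphStructureEmbedding (SimpleGraph.Embedding.induce S)),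
    Subsingleton.elim (_ ∘ default) (default : Empty → V)]
  exact hw

namespace Hgraph

section Adjacency

variable {n : ℕ} (i j : Fin n)

theorem adj_vv : (Hgraph n).Adj (.inl (.inl i)) (.inl (.inl j)) ↔
    (j : ℕ) = i + 1 ∨ (i : ℕ) = j + 1 := by
  simp only [Hgraph, SimpleGraph.fromRel_adj, HnRel, ne_eq, Sum.inl.injEq, Fin.ext_iff]
  omega

theorem adj_vu : (Hgraph n).Adj (.inl (.inl i)) (.inl (.inr j)) ↔ (i : ℕ) ≤ j := by
  simp [Hgraph, HnRel]

theorem adj_uv : (Hgraph n).Adj (.inl (.inr j)) (.inl (.inl i)) ↔ (i : ℕ) ≤ j := by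
  simp [Hgraph, HnRel]

theorem adj_uu : (Hgraph n).Adj (.inl (.inr i)) (.inl (.inr j)) ↔
    (i : ℕ) + 1 < j ∨ (j : ℕ) + 1 < i := by
  simp only [Hgraph, SimpleGraph.fromRel_adj, HnRel, ne_eq, Sum.inl.injEq, Sum.inr.injEq,
    Fin.ext_iff]
  omega

theorem adj_av : (Hgraph n).Adj (.inr false) (.inl (.inl i)) ↔ (i : ℕ) = 1 := by
  simp [Hgraph, HnRel]

theorem adj_va : (Hgraph n).Adj (.inl (.inl i)) (.inr false) ↔ (i : ℕ) = 1 := by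
  simp [Hgraph, HnRel]

theorem adj_au : (Hgraph n).Adj (.inr false) (.inl (.inr i)) ↔ 1 ≤ (i : ℕ) := by
  simp [Hgraph, HnRel]

theorem adj_ua : (Hgraph n).Adj (.inl (.inr i)) (.inr false) ↔ 1 ≤ (i : ℕ) := by
  simp [Hgraph, HnRel]

theorem adj_bv : (Hgraph n).Adj (.inr true) (.inl (.inl i)) ↔ (i : ℕ) = n - 2 := by
  simp [Hgraph, HnRel]

theorem adj_vb : (Hgraph n).Adj (.inl (.inl i)) (.inr true) ↔ (i : ℕ) = n - 2 := by
  simp [Hgraph, HnRel]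

theorem adj_bu : (Hgraph n).Adj (.inr true) (.inl (.inr i)) ↔ n - 2 ≤ (i : ℕ) := by
  simp [Hgraph, HnRel]

theorem adj_ub : (Hgraph n).Adj (.inl (.inr i)) (.inr true) ↔ n - 2 ≤ (i : ℕ) := by
  simp [Hgraph, HnRel]

theorem adj_ab (s t : Bool) : (Hgraph n).Adj (.inr s) (.inr t) ↔ False := by
  cases s <;> cases t <;> simp [Hgraph, HnRel]

end Adjacency

attribute [local simp] adj_vv adj_vu adj_uv adj_uu adj_av adj_va adj_au adj_ua adj_bv adj_vb
  adj_bu adj_ub adj_ab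

/-- The vertices of `H_n` other than the `u_i`; they induce a tree. -/
def InTree {n : ℕ} : HVert n → Prop
  | .inl (.inr _) => False
  | _ => True

section InTree

variable {n : ℕ} (i : Fin n) (s : Bool)

theorem inTree_v : InTree (n := n) (.inl (.inl i)) ↔ True := Iff.rfl

theorem inTree_u : InTree (n := n) (.inl (.inr i)) ↔ False := Iff.rfl

theorem inTree_ab : InTree (n := n) (.inr s) ↔ True := Iff.rfl

end InTree

attribute [local simp] inTree_v inTree_u inTree_ab

variable {n : ℕ} {p q r x y z : HVert n}

/-- The tree contains no triangle. -/
theorem exists_not_inTree_of_triangle (h₁ : (Hgraph n).Adj p q) (h₂ : (Hgraph n).Adj p r)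
    (h₃ : (Hgraph n).Adj q r) : ¬ InTree p ∨ ¬ InTree q ∨ ¬ InTree r := by
  rcases p with (i | i) | (_ | _) <;> rcases q with (j | j) | (_ | _) <;>
    rcases r with (k | k) | (_ | _) <;> simp at * <;> omega

theorem not_inTree_of_adj (h₁ : (Hgraph n).Adj p q) (h₂ : (Hgraph n).Adj p r)
    (h₃ : (Hgraph n).Adj q r) (hq : InTree q) (hr : InTree r) : ¬ InTree p := by
  have := exists_not_inTree_of_triangle h₁ h₂ h₃
  tauto

/-- No vertex `u_i` has three pairwise adjacent non-neighbours among the other `u_j`. -/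
theorem exists_inTree_of_not_adj (hp : ¬ InTree p) (hx : ¬ (Hgraph n).Adj x p)
    (hy : ¬ (Hgraph n).Adj y p) (hz : ¬ (Hgraph n).Adj z p) (hxp : x ≠ p) (hyp : y ≠ p)
    (hzp : z ≠ p) (hxy : x ≠ y) (hxz : x ≠ z) (hyz : y ≠ z) :
    InTree x ∨ InTree y ∨ InTree z := by
  by_contra! h
  obtain ⟨h₁, h₂, h₃⟩ := h
  rcases p with (i | i) | (_ | _) <;> rcases x with (j | j) | (_ | _) <;>
    rcases y with (k | k) | (_ | _) <;> rcases z with (l | l) | (_ | _) <;>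
    simp [Fin.ext_iff] at *
  omega

/-- A vertex without neighbours in a clique of size five avoiding it lies in the tree. -/
theorem inTree_of_clique {c : Fin 5 → HVert n} (hc : ∀ i j, i ≠ j → (Hgraph n).Adj (c i) (c j))
    (hp : ∀ i, ¬ (Hgraph n).Adj (c i) p) (hcp : ∀ i, c i ≠ p) : InTree p := by
  by_contra h
  have h₁ : ∀ i j k : Fin 5, i < j → j < k →
      ¬ InTree (c i) ∨ ¬ InTree (c j) ∨ ¬ InTree (c k) := fun i j k hij hjk =>
    exists_not_inTree_of_triangle (hc i j hij.ne) (hc i k (hij.trans hjk).ne) (hc j k hjk.ne)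
  have h₂ : ∀ i j k : Fin 5, i < j → j < k →
      InTree (c i) ∨ InTree (c j) ∨ InTree (c k) := fun i j k hij hjk =>
    exists_inTree_of_not_adj h (hp i) (hp j) (hp k) (hcp i) (hcp j) (hcp k)
      (hc i j hij.ne).ne (hc i k (hij.trans hjk).ne).ne (hc j k hjk.ne).ne
  simp [Fin.forall_fin_succ] at h₁ h₂
  grind

/-- Descent along the path `v_1, v_2, …`: a vertex attached to the tree in the way `v_i` is attached
to `v_{i+1}, v_{i+2}, v_{i+3}, u_{i+2}` lies in the tree. -/
theorem inTree_of_attached (hp : InTree p) (hq : InTree q) (hr : InTree r)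
    (hpq : (Hgraph n).Adj p q) (hqr : (Hgraph n).Adj q r) (hyp : (Hgraph n).Adj y p)
    (hyq : (Hgraph n).Adj y q) (hyr : ¬ (Hgraph n).Adj y r) (hxp : (Hgraph n).Adj x p)
    (hxq : ¬ (Hgraph n).Adj x q) (hxr : ¬ (Hgraph n).Adj x r) (hxy : (Hgraph n).Adj x y) :
    InTree x := by
  have hy := not_inTree_of_adj hyp hyq hpq hp hq
  by_contra hx
  rcases x with (i | i) | (_ | _) <;> simp only [inTree_v, inTree_u, inTree_ab, not_true] at hx
  rcases y with (j | j) | (_ | _) <;> simp only [inTree_v, inTree_u, inTree_ab, not_true] at hy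
  rcases p with (k | k) | (_ | _) <;> rcases q with (l | l) | (_ | _) <;>
    rcases r with (m | m) | (_ | _) <;> simp at * <;> omega

/-- `p` is the vertex `v_{k+1}`. -/
def IsV {n : ℕ} : HVert n → ℕ → Prop
  | .inl (.inl i), k => (i : ℕ) = k
  | _, _ => False

/-- `p` is the vertex `u_{k+1}`. -/
def IsU {n : ℕ} : HVert n → ℕ → Prop
  | .inl (.inr i), k => (i : ℕ) = k
  | _, _ => False

section IsVIsU

variable {n : ℕ} (i : Fin n) (s : Bool) (k : ℕ)

theorem isV_v : IsV (n := n) (.inl (.inl i)) k ↔ (i : ℕ) = k := Iff.rfl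

theorem isV_u : IsV (n := n) (.inl (.inr i)) k ↔ False := Iff.rfl

theorem isV_ab : IsV (n := n) (.inr s) k ↔ False := Iff.rfl

theorem isU_v : IsU (n := n) (.inl (.inl i)) k ↔ False := Iff.rfl

theorem isU_u : IsU (n := n) (.inl (.inr i)) k ↔ (i : ℕ) = k := Iff.rfl

theorem isU_ab : IsU (n := n) (.inr s) k ↔ False := Iff.rfl

end IsVIsU

attribute [local simp] isV_v isV_u isV_ab isU_v isU_u isU_ab

theorem IsV.eq {k : ℕ} {i : Fin n} (h : IsV p k) (hi : (i : ℕ) = k) : p = .inl (.inl i) := by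
  rcases p with (j | j) | (_ | _) <;> simp_all [Fin.ext_iff]

theorem IsU.eq {k : ℕ} {i : Fin n} (h : IsU p k) (hi : (i : ℕ) = k) : p = .inl (.inr i) := by
  rcases p with (j | j) | (_ | _) <;> simp_all [Fin.ext_iff]

/-- The only vertices of degree three in the tree are `v_2` and `v_{n-1}`. -/
theorem isV_of_fork (hp : InTree p) (hx : InTree x) (hy : InTree y) (hz : InTree z)
    (hpx : (Hgraph n).Adj p x) (hpy : (Hgraph n).Adj p y) (hpz : (Hgraph n).Adj p z)
    (hxy : x ≠ y) (hxz : x ≠ z) (hyz : y ≠ z) : IsV p 1 ∨ IsV p (n - 2) := by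
  rcases p with (i | i) | (_ | _) <;> rcases x with (j | j) | (_ | _) <;>
    rcases y with (k | k) | (_ | _) <;> rcases z with (l | l) | (_ | _) <;>
    simp [Fin.ext_iff] at * <;> omega

theorem isV_two (hn : 20 ≤ n) (hp : IsV p 1) (hx : InTree x) (hy : InTree y)
    (hpx : (Hgraph n).Adj p x) (hxy : (Hgraph n).Adj x y) (hyp : y ≠ p) : IsV x 2 := by
  rcases p with (i | i) | (_ | _) <;> rcases x with (j | j) | (_ | _) <;>
    rcases y with (k | k) | (_ | _) <;> simp [Fin.ext_iff] at * <;> omega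

theorem isV_sub_three (hn : 20 ≤ n) (hp : IsV p (n - 2)) (hx : InTree x) (hy : InTree y)
    (hpx : (Hgraph n).Adj p x) (hxy : (Hgraph n).Adj x y) (hyp : y ≠ p) : IsV x (n - 3) := by
  rcases p with (i | i) | (_ | _) <;> rcases x with (j | j) | (_ | _) <;>
    rcases y with (k | k) | (_ | _) <;> simp [Fin.ext_iff] at * <;> omega

theorem isV_succ {k : ℕ} (hk : 1 ≤ k) (hkn : k + 3 < n) (hp : IsV p k) (hx : IsV x (k + 1))
    (hy : InTree y) (hxy : (Hgraph n).Adj x y) (hyp : y ≠ p) : IsV y (k + 2) := by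
  rcases p with (i | i) | (_ | _) <;> rcases x with (j | j) | (_ | _) <;>
    rcases y with (l | l) | (_ | _) <;> simp [Fin.ext_iff] at * <;> omega

theorem isV_pred {k : ℕ} (hk : 1 < k) (hkn : k + 3 < n) (hp : IsV p (k + 2)) (hx : IsV x (k + 1))
    (hy : InTree y) (hxy : (Hgraph n).Adj x y) (hyp : y ≠ p) : IsV y k := by
  rcases p with (i | i) | (_ | _) <;> rcases x with (j | j) | (_ | _) <;>
    rcases y with (l | l) | (_ | _) <;> simp [Fin.ext_iff] at * <;> omega

/-- The vertex `v_3` has a neighbour in every clique of size four. -/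
theorem exists_adj_of_clique {c : Fin 4 → HVert n} (hc : ∀ i j, i ≠ j → (Hgraph n).Adj (c i) (c j))
    (hp : IsV p 2) : ∃ i, (Hgraph n).Adj (c i) p := by
  by_contra! h
  have h₁ : ∀ i j k : Fin 4, i ≠ j → i ≠ k → j ≠ k →
      ¬ InTree (c i) ∨ ¬ InTree (c j) ∨ ¬ InTree (c k) := fun i j k hij hik hjk =>
    exists_not_inTree_of_triangle (hc i j hij) (hc i k hik) (hc j k hjk)
  have h₂ : ∀ i j : Fin 4, i ≠ j → InTree (c i) ∨ InTree (c j) := by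
    intro i j hij
    have h₃ := hc i j hij
    have h₄ := h i
    have h₅ := h j
    generalize c i = q at *
    generalize c j = r at *
    clear h hc h₁
    rcases p with (i | i) | (_ | _) <;> rcases q with (j | j) | (_ | _) <;>
      rcases r with (k | k) | (_ | _) <;> simp at *
    omega
  simp [Fin.forall_fin_succ] at h₁ h₂
  grind

/-- The vertices around the right-hand fork are determined by `v_{n-1}` and `v_{n-2}`. -/
theorem right_fork (hn : 20 ≤ n) (hp : IsV p (n - 2)) (hz : IsV z (n - 3)) (hx : InTree x)
    (hy : InTree y) (hq : ¬ InTree q) (hpx : (Hgraph n).Adj x p) (hpy : (Hgraph n).Adj y p)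
    (hxy : x ≠ y) (hxz : x ≠ z) (hyz : y ≠ z) (hqp : (Hgraph n).Adj p q)
    (hqy : (Hgraph n).Adj y q) (hqx : ¬ (Hgraph n).Adj x q) :
    IsV x (n - 1) ∧ y = .inr true ∧ IsU q (n - 2) := by
  rcases q with (l | l) | (_ | _) <;> simp at hq
  rcases p with (i | i) | (_ | _) <;> simp at hp
  rcases z with (m | m) | (_ | _) <;> simp at hz
  rcases x with (j | j) | (_ | _) <;> rcases y with (k | k) | (_ | _) <;>
    simp [Fin.ext_iff] at * <;> omega

/-- The vertices around the left-hand fork are determined by `v_2` and `v_3`. -/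
theorem left_fork (hn : 20 ≤ n) (hp : IsV p 1) (hz : IsV z 2) (hx : InTree x)
    (hy : InTree y) (hpx : (Hgraph n).Adj p x) (hpy : (Hgraph n).Adj y p)
    (hxy : x ≠ y) (hxz : x ≠ z) (hyz : y ≠ z) (hqp : q ≠ p)
    (hqy : ¬ (Hgraph n).Adj y q) (hqx : (Hgraph n).Adj x q) :
    IsV x 0 ∧ y = .inr false ∧ IsU q 0 := by
  rcases p with (i | i) | (_ | _) <;> simp at hp
  rcases z with (m | m) | (_ | _) <;> simp at hz
  rcases x with (j | j) | (_ | _) <;> rcases y with (k | k) | (_ | _) <;>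
    rcases q with (l | l) | (_ | _) <;>
    simp [Fin.ext_iff] at * <;> omega

theorem isU_of_between {k : ℕ} (hp : ¬ InTree p) (hx : IsV x k) (hy : IsV y (k + 1))
    (hxp : (Hgraph n).Adj x p) (hyp : ¬ (Hgraph n).Adj y p) : IsU p k := by
  rcases p with (l | l) | (_ | _) <;> simp at hp
  rcases x with (j | j) | (_ | _) <;> rcases y with (k | k) | (_ | _) <;> simp at *
  omega

theorem isU_of_not_adj {k : ℕ} (hp : ¬ InTree p) (hx : IsV x (k + 1)) (hy : IsU y k)
    (hxp : (Hgraph n).Adj x p) (hyp : ¬ (Hgraph n).Adj y p) : IsU p (k + 1) := by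
  rcases p with (l | l) | (_ | _) <;> simp at hp
  rcases x with (j | j) | (_ | _) <;> rcases y with (k | k) | (_ | _) <;> simp at *
  omega

theorem isU_last (hp : ¬ InTree p) (hx : IsV x (n - 1)) (hxp : (Hgraph n).Adj x p) :
    IsU p (n - 1) := by
  rcases p with (l | l) | (_ | _) <;> simp at hp
  rcases x with (j | j) | (_ | _) <;> simp at *
  omega

theorem isU_sub_four (hn : 20 ≤ n) (hx : IsV x (n - 4)) (hy : IsV y (n - 3)) (hz : IsU z (n - 3))
    (hxp : (Hgraph n).Adj x p) (hyp : ¬ (Hgraph n).Adj y p) (hzp : ¬ (Hgraph n).Adj z p) :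
    IsU p (n - 4) := by
  rcases x with (j | j) | (_ | _) <;> simp at hx
  rcases y with (j | j) | (_ | _) <;> simp at hy
  rcases z with (j | j) | (_ | _) <;> simp at hz
  rcases p with (l | l) | (_ | _) <;> simp at * <;> omega

/-- Indices of the vertices near the two ends of `H_{m+20}`. -/
def endIndex (m : ℕ) (i : Fin 16) : Fin (m + 20) :=
  ⟨if (i : ℕ) < 12 then i else m + 4 + i, by split <;> omega⟩

/-- The vertices `v_i` and `u_i` of `H_{m+20}` with `i ≤ 12` or `i ≥ m + 17`, together with `a`
and `b`. -/
def ends (m : ℕ) : HVert 16 → HVert (m + 20) :=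
  Sum.map (Sum.map (endIndex m) (endIndex m)) id

theorem ends_v (m : ℕ) (i : Fin 16) : ends m (.inl (.inl i)) = .inl (.inl (endIndex m i)) := rfl

theorem ends_u (m : ℕ) (i : Fin 16) : ends m (.inl (.inr i)) = .inl (.inr (endIndex m i)) := rfl

theorem ends_ab (m : ℕ) (s : Bool) : ends m (.inr s) = .inr s := rfl

theorem endIndex_val (m : ℕ) (i : Fin 16) :
    (endIndex m i : ℕ) = if (i : ℕ) < 12 then (i : ℕ) else m + 4 + i := rfl

theorem endIndex_injective (m : ℕ) : Function.Injective (endIndex m) := by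
  intro i j h
  simp only [Fin.ext_iff, endIndex_val] at h ⊢
  split_ifs at h <;> omega

theorem ends_injective (m : ℕ) : Function.Injective (ends m) :=
  .sumMap (.sumMap (endIndex_injective m) (endIndex_injective m)) Function.injective_id

/-- The tuple `ends m` is the only one of its quantifier-free type. -/
theorem eq_ends_of_samePat {m m' : ℕ} {x : HVert 16 → HVert (m + 20)}
    (h : SamePat (Hgraph (m + 20)) x (Hgraph (m' + 20)) (ends m')) : x = ends m := by
  have inj : Function.Injective x := fun i j hij => ends_injective m' ((h.eq_iff i j).1 hij)
  obtain ⟨X, hX⟩ : ∃ X : Fin 16 → HVert (m + 20), ∀ i, x (.inl (.inl i)) = X i := ⟨_, fun _ => rfl⟩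
  obtain ⟨U, hU⟩ : ∃ U : Fin 16 → HVert (m + 20), ∀ i, x (.inl (.inr i)) = U i := ⟨_, fun _ => rfl⟩
  obtain ⟨A, hA⟩ : ∃ A, x (.inr false) = A := ⟨_, rfl⟩
  obtain ⟨B, hB⟩ : ∃ B, x (.inr true) = B := ⟨_, rfl⟩
  have vv : ∀ i j, (Hgraph (m + 20)).Adj (X i) (X j) ↔
      (j : ℕ) = i + 1 ∧ (i : ℕ) ≠ 11 ∨ (i : ℕ) = j + 1 ∧ (j : ℕ) ≠ 11 := by
    intro i j
    rw [← hX, ← hX, h.adj_iff, ends_v, ends_v, adj_vv, endIndex_val, endIndex_val]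
    split_ifs <;> omega
  have vu : ∀ i j, (Hgraph (m + 20)).Adj (X i) (U j) ↔ i ≤ j := by
    intro i j
    rw [← hX, ← hU, h.adj_iff, ends_v, ends_u, adj_vu, endIndex_val, endIndex_val]
    split_ifs <;> omega
  have uu : ∀ i j, (Hgraph (m + 20)).Adj (U i) (U j) ↔
      (i : ℕ) < j ∧ ¬((j : ℕ) = i + 1 ∧ (i : ℕ) ≠ 11) ∨
      (j : ℕ) < i ∧ ¬((i : ℕ) = j + 1 ∧ (j : ℕ) ≠ 11) := by
    intro i j
    rw [← hU, ← hU, h.adj_iff, ends_u, ends_u, adj_uu, endIndex_val, endIndex_val]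
    split_ifs <;> omega
  have av : ∀ i, (Hgraph (m + 20)).Adj A (X i) ↔ (i : ℕ) = 1 := by
    intro i
    rw [← hA, ← hX, h.adj_iff, ends_v, ends_ab, adj_av, endIndex_val]
    split_ifs <;> omega
  have au : ∀ i, (Hgraph (m + 20)).Adj A (U i) ↔ 1 ≤ (i : ℕ) := by
    intro i
    rw [← hA, ← hU, h.adj_iff, ends_u, ends_ab, adj_au, endIndex_val]
    split_ifs <;> omega
  have bv : ∀ i, (Hgraph (m + 20)).Adj B (X i) ↔ (i : ℕ) = 14 := by
    intro i
    rw [← hB, ← hX, h.adj_iff, ends_v, ends_ab, adj_bv, endIndex_val]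
    split_ifs <;> omega
  have bu : ∀ i, (Hgraph (m + 20)).Adj B (U i) ↔ 14 ≤ (i : ℕ) := by
    intro i
    rw [← hB, ← hU, h.adj_iff, ends_u, ends_ab, adj_bu, endIndex_val]
    split_ifs <;> omega
  have neXX : ∀ i j, i ≠ j → X i ≠ X j := fun i j hij => by
    rw [← hX, ← hX]; exact inj.ne (by simpa using hij)
  have neXA : ∀ i, X i ≠ A := fun i => by rw [← hX, ← hA]; exact inj.ne (by simp)
  have neXB : ∀ i, X i ≠ B := fun i => by rw [← hX, ← hB]; exact inj.ne (by simp)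
  have neUX : ∀ i j, U i ≠ X j := fun i j => by rw [← hX, ← hU]; exact inj.ne (by simp)
  have neUB : ∀ i, U i ≠ B := fun i => by rw [← hB, ← hU]; exact inj.ne (by simp)
  clear inj h
  let c : Fin 5 → HVert (m + 20) := fun i => U ⟨2 * i, by omega⟩
  have hc : ∀ i j, i ≠ j → (Hgraph (m + 20)).Adj (c i) (c j) := fun i j hij => by
    simp only [c, uu]; omega
  -- the right end
  have tX : ∀ i : Fin 16, 9 ≤ (i : ℕ) → InTree (X i) := fun i hi =>
    inTree_of_clique hc (fun j => by rw [SimpleGraph.adj_comm]; simp only [c, vu, Fin.le_def]; omega)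
      (fun j => neUX _ _)
  have tB : InTree B :=
    inTree_of_clique hc (fun j => by rw [SimpleGraph.adj_comm]; simp only [c, bu]; omega)
      (fun j => neUB _)
  have X14 : IsV (X 14) (m + 18) := by
    rcases isV_of_fork (tX 14 (by decide)) (tX 13 (by decide)) (tX 15 (by decide)) tB
      ((vv 14 13).2 (by decide)) ((vv 14 15).2 (by decide)) ((bv 14).2 (by decide)).symm
      (neXX _ _ (by decide)) (neXB _) (neXB _) with h | h
    · have X13 := isV_two (by omega) h (tX 13 (by decide)) (tX 12 (by decide))
        ((vv 14 13).2 (by decide)) ((vv 13 12).2 (by decide)) (neXX _ _ (by decide))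
      obtain ⟨i, hi⟩ := exists_adj_of_clique (c := fun i => c i.castSucc)
        (fun i j hij => hc _ _ (by simpa using hij)) X13
      rw [SimpleGraph.adj_comm] at hi
      simp only [c, vu, Fin.le_def] at hi
      have := i.2
      simp at hi
      omega
    · exact h
  have X13 : IsV (X 13) (m + 17) :=
    isV_sub_three (by omega) X14 (tX 13 (by decide)) (tX 12 (by decide))
        ((vv 14 13).2 (by decide)) ((vv 13 12).2 (by decide)) (neXX _ _ (by decide))
  have X12 : IsV (X 12) (m + 16) :=
    isV_pred (by omega) (by omega) X14 X13 (tX 12 (by decide)) ((vv 13 12).2 (by decide))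
      (neXX _ _ (by decide))
  have tU : ∀ i j k, InTree (X j) → InTree (X k) → j ≤ i → k ≤ i →
      (Hgraph (m + 20)).Adj (X j) (X k) → ¬ InTree (U i) := fun i j k hj hk hji hki hjk =>
    not_inTree_of_adj ((vu j i).2 hji).symm ((vu k i).2 hki).symm hjk hj hk
  -- the left end
  have step : ∀ i j k l : Fin 16, (j : ℕ) = i + 1 → (k : ℕ) = i + 2 → (l : ℕ) = i + 3 →
      (l : ℕ) ≤ 11 → InTree (X j) → InTree (X k) → InTree (X l) → InTree (X i) := by
    intro i j k l hj hk hl hl' tj tk tl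
    refine inTree_of_attached (y := U k) tj tk tl ?_ ?_ ?_ ?_ ?_ ?_ ?_ ?_ ?_
    · rw [vv]; omega
    · rw [vv]; omega
    · rw [SimpleGraph.adj_comm, vu]; omega
    · rw [SimpleGraph.adj_comm, vu]
    · rw [SimpleGraph.adj_comm, vu]; omega
    · rw [vv]; omega
    · rw [vv]; omega
    · rw [vv]; omega
    · rw [vu]; omega
  have t8 := step 8 9 10 11 rfl rfl rfl le_rfl (tX 9 le_rfl) (tX 10 (by decide)) (tX 11 (by decide))
  have t7 := step 7 8 9 10 rfl rfl rfl (by decide) t8 (tX 9 le_rfl) (tX 10 (by decide))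
  have t6 := step 6 7 8 9 rfl rfl rfl (by decide) t7 t8 (tX 9 le_rfl)
  have t5 := step 5 6 7 8 rfl rfl rfl (by decide) t6 t7 t8
  have t4 := step 4 5 6 7 rfl rfl rfl (by decide) t5 t6 t7
  have t3 := step 3 4 5 6 rfl rfl rfl (by decide) t4 t5 t6
  have t2 := step 2 3 4 5 rfl rfl rfl (by decide) t3 t4 t5
  have t1 := step 1 2 3 4 rfl rfl rfl (by decide) t2 t3 t4
  have t0 := step 0 1 2 3 rfl rfl rfl (by decide) t1 t2 t3
  have tA : InTree A := by
    refine inTree_of_attached (y := U 2) t1 t2 t3 ?_ ?_ ?_ ?_ ?_ ?_ ?_ ?_ ?_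
    · rw [vv]; decide
    · rw [vv]; decide
    · rw [SimpleGraph.adj_comm, vu]; decide
    · rw [SimpleGraph.adj_comm, vu]
    · rw [SimpleGraph.adj_comm, vu]; decide
    · rw [av]; decide
    · rw [av]; decide
    · rw [av]; decide
    · rw [au]; decide
  have tX' : ∀ i, InTree (X i) := by
    intro i
    by_cases hi : 9 ≤ (i : ℕ)
    · exact tX i hi
    · clear * - t0 t1 t2 t3 t4 t5 t6 t7 t8 hi
      fin_cases i <;> first | assumption | exact absurd (by decide) hi
  have X1 : IsV (X 1) 1 := by
    refine (isV_of_fork t1 t0 t2 tA ((vv 1 0).2 (by decide)) ((vv 1 2).2 (by decide))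
      ((av 1).2 (by decide)).symm (neXX _ _ (by decide)) (neXA _) (neXA _)).resolve_right ?_
    intro h
    have hi : m + 18 < m + 20 := by omega
    exact neXX 1 14 (by decide)
      ((h.eq (i := ⟨m + 18, hi⟩) rfl).trans (X14.eq (i := ⟨m + 18, hi⟩) rfl).symm)
  have X2 : IsV (X 2) 2 := isV_two (by omega) X1 t2 t3 ((vv 1 2).2 (by decide))
    ((vv 2 3).2 (by decide)) (neXX _ _ (by decide))
  have Xleft : ∀ k : ℕ, ∀ i j : Fin 16, (i : ℕ) = k + 1 → (j : ℕ) = k + 2 → k ≤ 9 →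
      IsV (X i) (k + 1) ∧ IsV (X j) (k + 2) := by
    intro k
    induction k with
    | zero =>
      intro i j hi hj _
      obtain rfl : i = 1 := Fin.ext hi
      obtain rfl : j = 2 := Fin.ext hj
      exact ⟨X1, X2⟩
    | succ k ih =>
      intro i j hi hj hk
      have h := ih ⟨k + 1, by omega⟩ i rfl hi (by omega)
      refine ⟨h.2, isV_succ (by omega) (by omega) h.1 h.2 (tX' j) ?_ (neXX _ _ ?_)⟩
      · rw [vv]; omega
      · simp [Fin.ext_iff]; omega
  have Xl : ∀ i : Fin 16, 1 ≤ (i : ℕ) → (i : ℕ) ≤ 10 → IsV (X i) i ∧ IsV (X (i + 1)) (i + 1) := by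
    intro i hi hi'
    have h := Xleft ((i : ℕ) - 1) i (i + 1) (by omega) (by simp [Fin.val_add]; omega) (by omega)
    rwa [show (i : ℕ) - 1 + 1 = i by omega, show (i : ℕ) - 1 + 2 = i + 1 by omega] at h
  have Ul : ∀ i : Fin 16, 1 ≤ (i : ℕ) → (i : ℕ) ≤ 10 → IsU (U i) i := by
    intro i hi hi'
    refine isU_of_between (tU i i ⟨i - 1, by omega⟩ (tX' _) (tX' _) le_rfl ?_ ?_) (Xl i hi hi').1
      (Xl i hi hi').2 ((vu _ _).2 le_rfl) ?_
    · simp [Fin.le_def]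
    · rw [vv]; simp only; omega
    · rw [vu, Fin.le_def, Fin.val_add]; simp; omega
  have X11 : IsV (X 11) 11 := (Xl 10 (by decide) (by decide)).2
  have U11 : IsU (U 11) 11 :=
    isU_of_not_adj (tU 11 11 10 (tX' _) (tX' _) le_rfl (by decide) ((vv _ _).2 (by decide))) X11
      (Ul 10 (by decide) (by decide)) ((vu _ _).2 le_rfl) (by rw [uu]; decide)
  obtain ⟨X0, rfl, U0⟩ := left_fork (q := U 0) (by omega) X1 X2 t0 tA ((vv 1 0).2 (by decide))
    ((av 1).2 (by decide)) (neXA 0) (neXX _ _ (by decide)) (neXA 2).symm (neUX 0 1)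
    (by rw [au]; decide) ((vu 0 0).2 le_rfl)
  obtain ⟨X15, rfl, U14⟩ := right_fork (q := U 14) (by omega) X14 X13 (tX' 15) tB
    (tU 14 13 14 (tX' _) (tX' _) (by decide) le_rfl ((vv _ _).2 (by decide)))
    ((vv 15 14).2 (by decide)) ((bv 14).2 (by decide)) (neXB 15) (neXX _ _ (by decide))
    (neXB 13).symm ((vu 14 14).2 le_rfl) ((bu 14).2 (by decide)) (by rw [vu]; decide)
  have U15 : IsU (U 15) (m + 19) :=
    isU_last (tU 15 14 13 (tX' _) (tX' _) (by decide) (by decide) ((vv _ _).2 (by decide))) X15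
      ((vu _ _).2 le_rfl)
  have U13 : IsU (U 13) (m + 17) :=
    isU_of_between (tU 13 12 13 (tX' _) (tX' _) (by decide) le_rfl ((vv _ _).2 (by decide))) X13
      X14 ((vu _ _).2 le_rfl) (by rw [vu]; decide)
  have U12 : IsU (U 12) (m + 16) :=
    isU_sub_four (by omega) X12 X13 U13
      ((vu _ _).2 le_rfl) (by rw [vu]; decide) (by rw [uu]; decide)
  have HX : ∀ i : Fin 16, IsV (X i) (endIndex m i) := by
    intro i
    rw [endIndex_val]
    by_cases hi : 1 ≤ (i : ℕ) ∧ (i : ℕ) ≤ 10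
    · rw [if_pos (by omega)]
      exact (Xl i hi.1 hi.2).1
    · clear * - X0 X11 X12 X13 X14 X15 hi
      fin_cases i <;> first | assumption | exact absurd (by decide) hi
  have HU : ∀ i : Fin 16, IsU (U i) (endIndex m i) := by
    intro i
    rw [endIndex_val]
    by_cases hi : 1 ≤ (i : ℕ) ∧ (i : ℕ) ≤ 10
    · rw [if_pos (by omega)]
      exact Ul i hi.1 hi.2
    · clear * - U0 U11 U12 U13 U14 U15 hi
      fin_cases i <;> first | assumption | exact absurd (by decide) hi
  funext p
  rcases p with (i | i) | (_ | _)
  · exact (hX i).trans ((HX i).eq rfl)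
  · exact (hU i).trans ((HU i).eq rfl)
  · exact hA
  · exact hB

end Hgraph

section Parts

variable {V W : Type} {G : SimpleGraph V} {H : SimpleGraph W}

/-- Relative to a copy `x` of the ends of `H_n`, the vertex `y` is adjacent to `v_1` and `v_2`. In
`H_n` this singles out the `u_i` with `i ≥ 2`. -/
def UPart (G : SimpleGraph V) (x : HVert 16 → V) (y : V) : Prop :=
  G.Adj y (x (.inl (.inl 0))) ∧ G.Adj y (x (.inl (.inl 1)))

/-- A property which in `H_n` singles out the `v_i` with `i ≥ 2`, relative to a copy `x` of the
ends of `H_n`. -/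
def VPart (G : SimpleGraph V) (x : HVert 16 → V) (y : V) : Prop :=
  ¬ G.Adj y (x (.inl (.inr 0))) ∧ y ≠ x (.inl (.inr 0)) ∧ ¬ UPart G x y ∧
    y ≠ x (.inr false) ∧ y ≠ x (.inr true)

/-- The vertex `z` certifies that `y'` is the successor of `y`. In `H_n` this holds for
`y = v_i`, `y' = v_{i+1}`, `z = u_i`. -/
def Link (G : SimpleGraph V) (x : HVert 16 → V) (y y' z : V) : Prop :=
  VPart G x y' ∧ G.Adj y y' ∧ UPart G x z ∧ G.Adj z y ∧ ¬ G.Adj z y'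

/-- The tuple `x` is a copy of the ends of some `H_n`. -/
def IsEnds (G : SimpleGraph V) (x : HVert 16 → V) : Prop :=
  ∃ m, SamePat G x (Hgraph (m + 20)) (Hgraph.ends m)

/-- Any six vertices, together with `x`, look like vertices of some `H_n` together with its
ends. -/
def IsLocal (G : SimpleGraph V) (x : HVert 16 → V) : Prop :=
  ∀ y : Fin 6 → V, ∃ (m : ℕ) (y' : Fin 6 → HVert (m + 20)),
    SamePat G (Sum.elim x y) (Hgraph (m + 20)) (Sum.elim (Hgraph.ends m) y')

/-- Every vertex of the path other than its last one has a successor. -/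
def HasSuccessors (G : SimpleGraph V) (x : HVert 16 → V) : Prop :=
  ∀ y, VPart G x y → y ≠ x (.inl (.inl 15)) → ∃ y' z, Link G x y y' z

namespace SamePat

variable {α β : Type} {x : HVert 16 → V} {x' : HVert 16 → W} {y : β → V} {y' : β → W}

theorem uPart_iff (h : SamePat G (Sum.elim x y) H (Sum.elim x' y')) (i : β) :
    UPart G x (y i) ↔ UPart H x' (y' i) :=
  and_congr (h.adj_iff (.inr i) (.inl (.inl (.inl 0))))
    (h.adj_iff (.inr i) (.inl (.inl (.inl 1))))

theorem vPart_iff (h : SamePat G (Sum.elim x y) H (Sum.elim x' y')) (i : β) :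
    VPart G x (y i) ↔ VPart H x' (y' i) :=
  and_congr (h.adj_iff (.inr i) (.inl (.inl (.inr 0)))).not <|
  and_congr (h.eq_iff (.inr i) (.inl (.inl (.inr 0)))).not <|
  and_congr (h.uPart_iff i).not <|
  and_congr (h.eq_iff (.inr i) (.inl (.inr false))).not
    (h.eq_iff (.inr i) (.inl (.inr true))).not

theorem link_iff (h : SamePat G (Sum.elim x y) H (Sum.elim x' y')) (i j k : β) :
    Link G x (y i) (y j) (y k) ↔ Link H x' (y' i) (y' j) (y' k) :=
  and_congr (h.vPart_iff j) <| and_congr (h.adj_iff (.inr i) (.inr j)) <|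
  and_congr (h.uPart_iff k) <| and_congr (h.adj_iff (.inr k) (.inr i))
    (h.adj_iff (.inr k) (.inr j)).not

end SamePat

theorem samePat_sumElim_of_embedding (f : G ↪g H) (x : HVert 16 → V) {β : Type} (y : β → V) :
    SamePat G (Sum.elim x y) H (Sum.elim (f ∘ x) (f ∘ y)) := by
  rw [← Sum.comp_elim]
  exact SamePat.of_embedding f _

theorem IsEnds.map {x : HVert 16 → V} (h : IsEnds G x) (f : G ↪g H) : IsEnds H (f ∘ x) :=
  h.imp fun _ hm => (SamePat.of_embedding f x).symm.trans hm

theorem IsLocal.comap {f : G ↪g H} {x : HVert 16 → V} (h : IsLocal H (f ∘ x)) : IsLocal G x := by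
  intro y
  obtain ⟨m, y', hy'⟩ := h (f ∘ y)
  exact ⟨m, y', (samePat_sumElim_of_embedding f x y).trans hy'⟩

theorem vPart_map_iff (f : G ↪g H) {x : HVert 16 → V} {y : V} :
    VPart H (f ∘ x) (f y) ↔ VPart G x y :=
  ((samePat_sumElim_of_embedding f x id).vPart_iff y).symm

theorem link_map_iff (f : G ↪g H) {x : HVert 16 → V} {y y' z : V} :
    Link H (f ∘ x) (f y) (f y') (f z) ↔ Link G x y y' z :=
  ((samePat_sumElim_of_embedding f x id).link_iff y y' z).symm

end Parts

namespace Hgraph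

attribute [local simp] adj_vv adj_vu adj_uv adj_uu adj_av adj_va adj_au adj_ua adj_bv adj_vb
  adj_bu adj_ub adj_ab isV_v isV_u isV_ab isU_v isU_u isU_ab

variable {m : ℕ} {p q r : HVert (m + 20)}

theorem endIndex_zero : (endIndex m 0 : ℕ) = 0 := rfl

theorem endIndex_one : (endIndex m 1 : ℕ) = 1 := rfl

theorem endIndex_last : (endIndex m 15 : ℕ) = m + 19 := rfl

theorem uPart_iff : UPart (Hgraph (m + 20)) (ends m) p ↔ ∃ i, 1 ≤ i ∧ IsU p i := by
  rcases p with (i | i) | (_ | _) <;> simp [UPart, ends_v, endIndex_zero, endIndex_one, -Fin.val_eq_zero_iff]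
  omega

theorem vPart_iff : VPart (Hgraph (m + 20)) (ends m) p ↔ ∃ i, 1 ≤ i ∧ IsV p i := by
  rcases p with (i | i) | (_ | _) <;>
    simp [VPart, uPart_iff, ends_u, ends_ab, endIndex_zero, Fin.ext_iff, -Fin.val_eq_zero_iff]
  omega

theorem exists_of_link (hp : VPart (Hgraph (m + 20)) (ends m) p)
    (h : Link (Hgraph (m + 20)) (ends m) p q r) :
    ∃ i, 1 ≤ i ∧ IsV p i ∧ IsV q (i + 1) ∧ IsU r i := by
  obtain ⟨hq, hpq, hr, hrp, hrq⟩ := h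
  rw [vPart_iff] at hp hq
  rw [uPart_iff] at hr
  rcases p with (i | i) | (_ | _) <;> simp at hp
  rcases q with (j | j) | (_ | _) <;> simp at hq
  rcases r with (k | k) | (_ | _) <;> simp at hr
  simp at *
  omega

theorem hasSuccessors : HasSuccessors (Hgraph (m + 20)) (ends m) := by
  intro p hp hne
  rw [vPart_iff] at hp
  rcases p with (i | i) | (_ | _) <;> simp at hp
  simp [ends_v, endIndex_last, Fin.ext_iff] at hne
  refine ⟨.inl (.inl ⟨i + 1, by omega⟩), .inl (.inr i), ?_⟩
  simp only [Link, vPart_iff, uPart_iff]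
  simp
  omega

theorem isEnds : IsEnds (Hgraph (m + 20)) (ends m) :=
  ⟨m, fun _ _ => ⟨Iff.rfl, Iff.rfl⟩⟩

theorem adj_of_adj_succ {i : ℕ} {u : HVert (m + 20)} (hp : IsV p i) (hq : IsV q (i + 1))
    (hu : UPart (Hgraph (m + 20)) (ends m) u) (h : (Hgraph (m + 20)).Adj u q) :
    (Hgraph (m + 20)).Adj u p := by
  rw [uPart_iff] at hu
  rcases p with (k | k) | (_ | _) <;> simp at hp
  rcases q with (j | j) | (_ | _) <;> simp at hq
  rcases u with (l | l) | (_ | _) <;> simp at *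
  omega

theorem adj_iff_le {i j : ℕ} (hp : IsV p i) (hr : IsU r j) :
    (Hgraph (m + 20)).Adj r p ↔ i ≤ j := by
  rcases p with (k | k) | (_ | _) <;> simp at hp
  rcases r with (l | l) | (_ | _) <;> simp at hr
  simp [hp, hr]

theorem isV_ends_one : IsV (ends m (.inl (.inl 1))) 1 := rfl

theorem isV_ends_last : IsV (ends m (.inl (.inl 15))) (m + 19) := rfl

theorem isU_ends_last : IsU (ends m (.inl (.inr 15))) (m + 19) := rfl

theorem IsV.lt {i : ℕ} (hp : IsV p i) : i < m + 20 := by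
  rcases p with (k | k) | (_ | _) <;> simp at hp
  omega

theorem IsU.lt {i : ℕ} (hp : IsU p i) : i < m + 20 := by
  rcases p with (k | k) | (_ | _) <;> simp at hp
  omega

theorem IsV.eq_iff {i j : ℕ} (hp : IsV p i) (hq : IsV q j) : p = q ↔ i = j := by
  rcases p with (k | k) | (_ | _) <;> simp at hp
  rcases q with (l | l) | (_ | _) <;> simp at hq
  simp [Fin.ext_iff, hp, hq]

theorem IsU.eq_iff {i j : ℕ} (hp : IsU p i) (hq : IsU q j) : p = q ↔ i = j := by
  rcases p with (k | k) | (_ | _) <;> simp at hp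
  rcases q with (l | l) | (_ | _) <;> simp at hq
  simp [Fin.ext_iff, hp, hq]

end Hgraph

namespace IsLocal

variable {V : Type} {G : SimpleGraph V} {x : HVert 16 → V} {y y' y'' z z' u w : V}

theorem eq_or_part (hL : IsLocal G x) (w : V) : (∃ i, w = x i) ∨ VPart G x w ∨ UPart G x w := by
  obtain ⟨m, t, h⟩ := hL fun _ => w
  have hv := h.vPart_iff 0
  have hu := h.uPart_iff 0
  have he := fun i => h.eq_iff (.inr 0) (.inl i)
  simp only [Sum.elim_inl, Sum.elim_inr] at he
  rw [hv, hu, Hgraph.vPart_iff, Hgraph.uPart_iff]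
  simp only [he]
  rcases t 0 with (i | i) | s
  · by_cases hi : (i : ℕ) = 0
    · exact .inl ⟨.inl (.inl 0), congrArg (fun j => Sum.inl (Sum.inl j)) (Fin.ext hi)⟩
    · exact .inr (.inl ⟨i, Nat.pos_of_ne_zero hi, rfl⟩)
  · by_cases hi : (i : ℕ) = 0
    · exact .inl ⟨.inl (.inr 0), congrArg (fun j => Sum.inl (Sum.inr j)) (Fin.ext hi)⟩
    · exact .inr (.inr ⟨i, Nat.pos_of_ne_zero hi, rfl⟩)
  · exact .inl ⟨.inr s, rfl⟩

theorem adj_of_link (hL : IsLocal G x) (hy : VPart G x y) (hl : Link G x y y' z)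
    (hu : UPart G x u) (huy : G.Adj u y') : G.Adj u y := by
  obtain ⟨m, t, h⟩ := hL ![y, y', z, u, u, u]
  obtain ⟨i, -, hp, hq, -⟩ := Hgraph.exists_of_link ((h.vPart_iff 0).1 hy) ((h.link_iff 0 1 2).1 hl)
  exact (h.adj_iff (.inr 3) (.inr 0)).2 <|
    Hgraph.adj_of_adj_succ hp hq ((h.uPart_iff 3).1 hu) ((h.adj_iff (.inr 3) (.inr 1)).1 huy)

/-- Following links strictly decreases the number of neighbours among the `u_i`. -/
theorem false_of_links [Finite V] (hL : IsLocal G x) {S : V → Prop}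
    (hS : ∀ y, S y → VPart G x y ∧ ∃ y' z, Link G x y y' z ∧ S y') : ∀ y, ¬ S y := by
  suffices ∀ n y, S y → {u | UPart G x u ∧ G.Adj u y}.ncard = n → False from
    fun y hy => this _ y hy rfl
  intro n
  induction n using Nat.strong_induction_on with
  | _ n ih =>
    intro y hy hn
    obtain ⟨hyV, y', z, hl, hy'⟩ := hS y hy
    refine ih _ ?_ y' hy' rfl
    rw [← hn]
    refine Set.ncard_lt_ncard ((Set.ssubset_iff_of_subset ?_).2 ⟨z, ?_, ?_⟩) (Set.toFinite _)
    · exact fun u hu => ⟨hu.1, hL.adj_of_link hyV hl hu.1 hu.2⟩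
    · exact ⟨hl.2.2.1, hl.2.2.2.1⟩
    · exact fun h => hl.2.2.2.2 h.2

theorem v_start (hL : IsLocal G x) (hw : VPart G x w) (hne : w ≠ x (.inl (.inl 1)))
    (hl : Link G x (x (.inl (.inl 1))) y' z) : ¬ G.Adj z w := by
  obtain ⟨m, t, h⟩ := hL ![x (.inl (.inl 1)), y', z, w, w, w]
  have hv : t 0 = _ := (h.eq_iff (.inr 0) (.inl (.inl (.inl 1)))).1 rfl
  have hl := (h.link_iff 0 1 2).1 hl
  have hw := (h.vPart_iff 3).1 hw
  have hne := (h.eq_iff (.inr 3) (.inl (.inl (.inl 1)))).not.1 hne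
  refine (h.adj_iff (.inr 2) (.inr 3)).not.2 ?_
  simp only [Sum.elim_inl, Sum.elim_inr] at hv hl hw hne ⊢
  have h1 := Hgraph.isV_ends_one (m := m)
  rw [← hv] at h1 hne
  obtain ⟨i, hi, hp, hq, hr⟩ := Hgraph.exists_of_link (Hgraph.vPart_iff.2 ⟨1, le_rfl, h1⟩) hl
  obtain ⟨j, hj, hw⟩ := Hgraph.vPart_iff.1 hw
  rw [Hgraph.IsV.eq_iff hw h1] at hne
  have := (Hgraph.IsV.eq_iff hp h1).1 rfl
  rw [Hgraph.adj_iff_le hw hr]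
  omega

theorem v_step (hL : IsLocal G x) (hw : VPart G x w) (hy : VPart G x y) (hl : Link G x y y' z)
    (hzw : ¬ G.Adj z w) (hne : y' ≠ w) :
    y' ≠ x (.inl (.inl 15)) ∧ ∀ y'' z', Link G x y' y'' z' → ¬ G.Adj z' w := by
  have key : ∀ y'' z', y' ≠ x (.inl (.inl 15)) ∧ (Link G x y' y'' z' → ¬ G.Adj z' w) := by
    intro y'' z'
    obtain ⟨m, t, h⟩ := hL ![y, y', z, w, y'', z']
    obtain ⟨i, hi, hp, hq, hr⟩ :=
      Hgraph.exists_of_link ((h.vPart_iff 0).1 hy) ((h.link_iff 0 1 2).1 hl)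
    obtain ⟨j, hj, hw⟩ := Hgraph.vPart_iff.1 ((h.vPart_iff 3).1 hw)
    have hzw := (h.adj_iff (.inr 2) (.inr 3)).not.1 hzw
    have hne := (h.eq_iff (.inr 1) (.inr 3)).not.1 hne
    simp only [Sum.elim_inr] at hzw hne
    rw [Hgraph.adj_iff_le hw hr] at hzw
    rw [Hgraph.IsV.eq_iff hq hw] at hne
    have hj' := Hgraph.IsV.lt hw
    refine ⟨(h.eq_iff (.inr 1) (.inl (.inl (.inl 15)))).not.2 ?_, fun hl' => ?_⟩
    · simp only [Sum.elim_inl, Sum.elim_inr]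
      rw [Hgraph.IsV.eq_iff hq Hgraph.isV_ends_last]
      omega
    · obtain ⟨k, hk, hq', -, hr'⟩ :=
        Hgraph.exists_of_link ((h.vPart_iff 1).1 hl.1) ((h.link_iff 1 4 5).1 hl')
      have := (Hgraph.IsV.eq_iff hq hq').1 rfl
      refine (h.adj_iff (.inr 5) (.inr 3)).not.2 ?_
      simp only [Sum.elim_inr]
      rw [Hgraph.adj_iff_le hw hr']
      omega
  exact ⟨(key y y).1, fun y'' z' => (key y'' z').2⟩

theorem u_step (hL : IsLocal G x) (hw : UPart G x w) (hy : VPart G x y) (hl : Link G x y y' z)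
    (hwy : G.Adj w y) (hne : w ≠ z) (hne' : w ≠ x (.inl (.inr 15))) :
    y' ≠ x (.inl (.inl 15)) ∧ G.Adj w y' := by
  obtain ⟨m, t, h⟩ := hL ![y, y', z, w, w, w]
  obtain ⟨i, hi, hp, hq, hr⟩ :=
    Hgraph.exists_of_link ((h.vPart_iff 0).1 hy) ((h.link_iff 0 1 2).1 hl)
  obtain ⟨j, hj, hw⟩ := Hgraph.uPart_iff.1 ((h.uPart_iff 3).1 hw)
  have hwy := (h.adj_iff (.inr 3) (.inr 0)).1 hwy
  have hne := (h.eq_iff (.inr 3) (.inr 2)).not.1 hne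
  have hne' := (h.eq_iff (.inr 3) (.inl (.inl (.inr 15)))).not.1 hne'
  simp only [Sum.elim_inl, Sum.elim_inr] at hwy hne hne'
  rw [Hgraph.adj_iff_le hp hw] at hwy
  rw [Hgraph.IsU.eq_iff hw hr] at hne
  rw [Hgraph.IsU.eq_iff hw Hgraph.isU_ends_last] at hne'
  have hj' := Hgraph.IsU.lt hw
  refine ⟨(h.eq_iff (.inr 1) (.inl (.inl (.inl 15)))).not.2 ?_,
    (h.adj_iff (.inr 3) (.inr 1)).2 ?_⟩
  · simp only [Sum.elim_inl, Sum.elim_inr]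
    rw [Hgraph.IsV.eq_iff hq Hgraph.isV_ends_last]
    omega
  · simp only [Sum.elim_inr]
    rw [Hgraph.adj_iff_le hq hw]
    omega

end IsLocal

theorem vPart_one {V : Type} {G : SimpleGraph V} {x : HVert 16 → V} (hx : IsEnds G x) :
    VPart G x (x (.inl (.inl 1))) ∧ x (.inl (.inl 1)) ≠ x (.inl (.inl 15)) := by
  obtain ⟨m, h⟩ := hx
  have h' : SamePat G (Sum.elim x x) (Hgraph (m + 20))
      (Sum.elim (Hgraph.ends m) (Hgraph.ends m)) := by
    simpa only [Sum.comp_elim, Function.comp_id] using h.comp (Sum.elim id id)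
  refine ⟨(h'.vPart_iff (.inl (.inl 1))).2
    (Hgraph.vPart_iff.2 ⟨1, le_rfl, Hgraph.isV_ends_one⟩), (h.eq_iff _ _).not.2 ?_⟩
  rw [Hgraph.IsV.eq_iff Hgraph.isV_ends_one Hgraph.isV_ends_last]
  omega

/-- If `x` extends to a copy of the ends in `H` and `H` is local, then an induced subgraph of `H`
which has successors is all of `H`. -/
theorem surjective_of_hasSuccessors {V W : Type} [Finite V] {G : SimpleGraph V}
    {H : SimpleGraph W} {x : HVert 16 → V} (f : G ↪g H) (hx : IsEnds G x)
    (hs : HasSuccessors G x) (hL : IsLocal H (f ∘ x)) : Function.Surjective f := by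
  intro w
  by_contra! hw
  have hLG : IsLocal G x := hL.comap
  obtain ⟨h1, h1'⟩ := vPart_one hx
  rcases hL.eq_or_part w with ⟨i, rfl⟩ | hwV | hwU
  · exact hw _ rfl
  · obtain ⟨y', z, hl⟩ := hs _ h1 h1'
    refine hLG.false_of_links
      (S := fun y => VPart G x y ∧ ∃ y' z, Link G x y y' z ∧ ¬ H.Adj (f z) w) ?_ _
      ⟨h1, y', z, hl, hL.v_start hwV (hw _).symm ((link_map_iff f).2 hl)⟩
    rintro y ⟨hy, y', z, hl, hzw⟩
    obtain ⟨h2, h3⟩ := hL.v_step hwV ((vPart_map_iff f).2 hy) ((link_map_iff f).2 hl) hzw (hw _)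
    obtain ⟨y'', z', hl'⟩ := hs y' hl.1 fun h => h2 (congrArg f h)
    exact ⟨hy, y', z, hl, hl.1, y'', z', hl', h3 _ _ ((link_map_iff f).2 hl')⟩
  · refine hLG.false_of_links
      (S := fun y => VPart G x y ∧ y ≠ x (.inl (.inl 15)) ∧ H.Adj w (f y)) ?_ _ ⟨h1, h1', hwU.2⟩
    rintro y ⟨hy, hne, hwy⟩
    obtain ⟨y', z, hl⟩ := hs y hy hne
    obtain ⟨h2, h3⟩ := hL.u_step hwU ((vPart_map_iff f).2 hy) ((link_map_iff f).2 hl) hwy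
      (hw _).symm (hw _).symm
    exact ⟨hy, y', z, hl, hl.1, fun h => h2 (congrArg f h), h3⟩

theorem HasSuccessors.map {V W : Type} {G : SimpleGraph V} {H : SimpleGraph W}
    {x : HVert 16 → V} (hs : HasSuccessors G x) (f : G ↪g H) (hf : Function.Surjective f) :
    HasSuccessors H (f ∘ x) := by
  intro y hy hne
  obtain ⟨y, rfl⟩ := hf y
  obtain ⟨y', z, hl⟩ := hs y ((vPart_map_iff f).1 hy) fun h => hne (congrArg f h)
  exact ⟨f y', f z, (link_map_iff f).2 hl⟩

/-- The property that, for a suitable copy of the ends, the graph either fails to look locally like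
some `H_n` or contains the whole path. -/
def HasPath {V : Type} (G : SimpleGraph V) : Prop :=
  ∃ x, IsEnds G x ∧ (¬ IsLocal G x ∨ HasSuccessors G x)

theorem HasPath.map {V W : Type} [Finite V] {G : SimpleGraph V} {H : SimpleGraph W}
    (h : HasPath G) (f : G ↪g H) : HasPath H := by
  obtain ⟨x, hx, h⟩ := h
  refine ⟨f ∘ x, hx.map f, ?_⟩
  by_contra! hn
  have hs := h.resolve_left (not_not.2 hn.1.comap)
  exact hn.2 (hs.map f (surjective_of_hasSuccessors f hx hs hn.1))

section Definability

theorem GDef.isEnds : GDef fun V G (x : HVert 16 → V) => IsEnds G x :=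
  .of_samePat fun _ _ _ _ _ _ h hx => hx.imp fun _ hm => h.symm.trans hm

theorem GDef.isLocal : GDef fun V G (x : HVert 16 → V) => IsLocal G x :=
  .all (β := Fin 6) (P := fun _ G xy => ∃ (m : ℕ) (y' : Fin 6 → HVert (m + 20)),
    SamePat G xy (Hgraph (m + 20)) (Sum.elim (Hgraph.ends m) y')) <|
  .of_samePat fun _ _ _ _ _ _ h ⟨m, y', hy⟩ => ⟨m, y', h.symm.trans hy⟩

theorem GDef.hasSuccessors : GDef fun V G (x : HVert 16 → V) => HasSuccessors G x := by
  have h : GDef fun V G (x : HVert 16 → V) => ∀ y : Fin 1 → V, ∃ z : Fin 2 → V,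
      VPart G x (y 0) → y 0 ≠ x (.inl (.inl 15)) → Link G x (y 0) (z 0) (z 1) := by
    refine .all (β := Fin 1) (P := fun V G (xy : HVert 16 ⊕ Fin 1 → V) => ∃ z : Fin 2 → V,
      VPart G (xy ∘ .inl) (xy (.inr 0)) →
      xy (.inr 0) ≠ xy (.inl (.inl (.inl 15))) →
      Link G (xy ∘ .inl) (xy (.inr 0)) (z 0) (z 1)) ?_
    refine .ex (β := Fin 2) (P := fun V G (t : (HVert 16 ⊕ Fin 1) ⊕ Fin 2 → V) =>
      VPart G (t ∘ .inl ∘ .inl) (t (.inl (.inr 0))) →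
      t (.inl (.inr 0)) ≠ t (.inl (.inl (.inl (.inl 15)))) →
      Link G (t ∘ .inl ∘ .inl) (t (.inl (.inr 0))) (t (.inr 0)) (t (.inr 1))) ?_
    refine .of_samePat fun V W G H t t' h ht hv hne => ?_
    have h' : SamePat G (Sum.elim (t ∘ .inl ∘ .inl) t) H (Sum.elim (t' ∘ .inl ∘ .inl) t') := by
      simpa only [Sum.comp_elim, Function.comp_id] using h.comp (Sum.elim (.inl ∘ .inl) id)
    exact (h'.link_iff _ _ _).1 (ht ((h'.vPart_iff _).2 hv) ((h.eq_iff _ _).not.2 hne))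
  obtain ⟨φ, hφ⟩ := h
  refine ⟨φ, fun V G x => (hφ V G x).trans ⟨fun h y hy hne => ?_, fun h y => ?_⟩⟩
  · obtain ⟨z, hz⟩ := h fun _ => y
    exact ⟨z 0, z 1, hz hy hne⟩
  · by_cases hy : VPart G x (y 0) ∧ y 0 ≠ x (.inl (.inl 15))
    · obtain ⟨y', z, hl⟩ := h _ hy.1 hy.2
      exact ⟨![y', z], fun _ _ => hl⟩
    · exact ⟨fun _ => y 0, fun h₁ h₂ => (hy ⟨h₁, h₂⟩).elim⟩

theorem GDef.exists_sentence {α : Type} [Finite α] {P : ∀ V : Type, SimpleGraph V → (α → V) → Prop}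
    (h : GDef P) : ∃ φ : Language.graph.Sentence, ∀ (V : Type) (G : SimpleGraph V),
      GSat G φ ↔ ∃ x, P V G x := by
  obtain ⟨φ, hφ⟩ := h
  refine ⟨(φ.relabel (Sum.inr : α → Empty ⊕ α)).iExs α, fun V G => ?_⟩
  let := G.structure
  refine (Formula.realize_iExs (L := Language.graph)).trans (exists_congr fun x => ?_)
  rw [Formula.realize_relabel, Sum.elim_comp_inr, hφ]

theorem exists_sentence_hasPath : ∃ φ : Language.graph.Sentence,
    ∀ (V : Type) (G : SimpleGraph V), GSat G φ ↔ HasPath G :=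
  (GDef.isEnds.and (GDef.isLocal.not.or GDef.hasSuccessors)).exists_sentence

end Definability

namespace Hgraph

theorem hasPath (m : ℕ) : HasPath (Hgraph (m + 20)) :=
  ⟨ends m, isEnds, .inr hasSuccessors⟩

variable {m : ℕ}

/-- The vertex `v_{c+13}` of `H_{m+20}`, which is not among the ends. -/
def middle (c : Fin (m + 4)) : HVert (m + 20) :=
  .inl (.inl ⟨c + 12, by omega⟩)

theorem middle_injective : Function.Injective (middle (m := m)) := by
  intro c d h
  simpa [middle, Fin.ext_iff] using h

theorem exists_avoiding {k : ℕ} (hk : k < m + 4) (w : Fin k → HVert (m + 20)) :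
    ∃ c : Fin (m + 4), ∀ i, w i ∈ {p | p ≠ middle c} := by
  by_contra! h
  simp only [Set.mem_ofPred_eq, ne_eq, not_not] at h
  choose g hg using h
  have : Function.Injective g := fun c d hcd =>
    middle_injective ((hg c).symm.trans ((congrArg w hcd).trans (hg d)))
  have := Fintype.card_le_of_injective g this
  simp at this
  omega

theorem not_hasPath_induce (c : Fin (m + 4)) :
    ¬ HasPath ((Hgraph (m + 20)).induce {p | p ≠ middle c}) := by
  rintro ⟨x, ⟨m', hx⟩, h⟩
  let f := SimpleGraph.Embedding.induce (G := Hgraph (m + 20)) {p | p ≠ middle c}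
  have he : f ∘ x = ends m := eq_ends_of_samePat ((SamePat.of_embedding f x).symm.trans hx)
  rcases h with h | h
  · refine h fun y => ⟨m, f ∘ y, ?_⟩
    rw [← he]
    exact samePat_sumElim_of_embedding f x y
  · have hp : IsV (.inl (.inl ⟨c + 11, by omega⟩) : HVert (m + 20)) (c + 11) := rfl
    have hpc : IsV (middle c) (c + 12) := rfl
    obtain ⟨y, hy⟩ : ∃ y, f y = .inl (.inl ⟨c + 11, by omega⟩) :=
      ⟨⟨_, fun h => by have := (hp.eq_iff hpc).1 h; omega⟩, rfl⟩
    rw [← hy] at hp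
    have hyV : VPart (Hgraph (m + 20)) (f ∘ x) (f y) := by
      rw [he, vPart_iff]
      exact ⟨_, by omega, hp⟩
    obtain ⟨y', z, hl⟩ := h y ((vPart_map_iff f).1 hyV) (by
      intro h
      have : f y = (f ∘ x) (.inl (.inl 15)) := congrArg f h
      rw [he, hp.eq_iff isV_ends_last] at this
      omega)
    rw [← link_map_iff f, he] at hl
    rw [he] at hyV
    obtain ⟨i, -, hi, hq, -⟩ := exists_of_link hyV hl
    have := (hp.eq_iff hi).1 rfl
    exact y'.2 ((hq.eq_iff hpc).2 (by omega))

end Hgraph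

/-- Extension preservation fails on any hereditary, isomorphism-closed class of finite graphs
containing the graphs `H_n` for arbitrarily large `n`. -/
theorem stmt_5 (C : ∀ V : Type, SimpleGraph V → Prop)
    (hfin : ∀ (V : Type) (G : SimpleGraph V), C V G → Finite V)
    (hher : ∀ (V : Type) (G : SimpleGraph V) (S : Set V), C V G → C S (G.induce S))
    (hiso : ∀ (V W : Type) (G : SimpleGraph V) (H : SimpleGraph W),
      C V G → (G ≃g H) → C W H)
    (hHn : ∀ N : ℕ, ∃ n : ℕ, N ≤ n ∧ C (HVert n) (Hgraph n)) :
    ∃ φ : Language.graph.Sentence,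
      (∀ (V W : Type) (G : SimpleGraph V) (H : SimpleGraph W),
        C V G → C W H → (G ↪g H) → GSat G φ → GSat H φ) ∧
      ¬ ∃ ψ : Language.graph.Sentence, IsExistentialSentence ψ ∧
          ∀ (V : Type) (G : SimpleGraph V), C V G → (GSat G φ ↔ GSat G ψ) := by
  obtain ⟨φ, hφ⟩ := exists_sentence_hasPath
  refine ⟨φ, fun V W G H hG _ f h => ?_, ?_⟩
  · have := hfin V G hG
    rw [hφ] at h ⊢
    exact h.map f
  · rintro ⟨ψ, hψ, h⟩
    obtain ⟨k, hk⟩ := hψ.exists_witnesses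
    obtain ⟨n, hn, hC⟩ := hHn (k + 20)
    obtain ⟨m, rfl⟩ : ∃ m, n = m + 20 := ⟨n - 20, by omega⟩
    obtain ⟨w, hw⟩ := hk _ _ ((h _ _ hC).1 ((hφ _ _).2 (Hgraph.hasPath m)))
    obtain ⟨c, hc⟩ := Hgraph.exists_avoiding (by omega) w
    refine Hgraph.not_hasPath_induce c ((hφ _ _).1 ((h _ _ (hher _ _ _ hC)).2 (hw _ hc)))
end

section
/- For every d ∈ ℕ, let D_d be the class of all finite simple graphs G such that either the maximum degree of G is at most d, or the maximum degree of the complement graph of G is at most d. Then extension preservation holds over D_d: every first-order sentence in the language of graphs that is preserved by embeddings over D_d is equivalent over D_d to an existential sentence. -/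
open FirstOrder Language

/-- The class `D_d` of finite graphs in which either the graph or its complement has maximum
degree at most `d`. -/
def Dclass (d : ℕ) : ∀ V : Type, SimpleGraph V → Prop := fun _ G =>
  (∀ v, (G.neighborSet v).ncard ≤ d) ∨ (∀ v, (Gᶜ.neighborSet v).ncard ≤ d)

namespace SimpleGraph

variable {V W U : Type} {ι : Type}

/-- The vertices that lie in `S` or are adjacent to a vertex of `S`. -/
def closedNhd (G : SimpleGraph V) (S : Set V) : Set V := S ∪ {v | ∃ u ∈ S, G.Adj u v}

/-- The vertices at distance at most `r` from `S`. -/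
def nhdBall (G : SimpleGraph V) (r : ℕ) (S : Set V) : Set V := G.closedNhd^[r] S

section Balls

variable {G : SimpleGraph V} {S T : Set V} {r s d : ℕ}

lemma subset_closedNhd : S ⊆ G.closedNhd S := Set.subset_union_left

lemma closedNhd_mono (h : S ⊆ T) : G.closedNhd S ⊆ G.closedNhd T := by
  rintro v (hv | ⟨u, hu, huv⟩)
  · exact Or.inl (h hv)
  · exact Or.inr ⟨u, h hu, huv⟩

lemma nhdBall_zero : G.nhdBall 0 S = S := rfl

lemma nhdBall_succ : G.nhdBall (r + 1) S = G.closedNhd (G.nhdBall r S) :=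
  Function.iterate_succ_apply' _ _ _

lemma nhdBall_one : G.nhdBall 1 S = G.closedNhd S := rfl

lemma nhdBall_add : G.nhdBall (r + s) S = G.nhdBall r (G.nhdBall s S) :=
  Function.iterate_add_apply _ _ _ _

lemma nhdBall_mono (h : S ⊆ T) : G.nhdBall r S ⊆ G.nhdBall r T := by
  induction r with
  | zero => exact h
  | succ r ih => rw [nhdBall_succ, nhdBall_succ]; exact closedNhd_mono ih

lemma subset_nhdBall : S ⊆ G.nhdBall r S := by
  induction r with
  | zero => exact subset_rfl
  | succ r ih => rw [nhdBall_succ]; exact ih.trans subset_closedNhd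

lemma nhdBall_mono_radius (h : r ≤ s) : G.nhdBall r S ⊆ G.nhdBall s S := by
  obtain ⟨k, rfl⟩ := Nat.exists_eq_add_of_le h
  rw [add_comm, nhdBall_add]
  exact subset_nhdBall

lemma mem_nhdBall_iff {v : V} : v ∈ G.nhdBall r S ↔ ∃ u ∈ S, v ∈ G.nhdBall r {u} := by
  constructor
  · intro h
    induction r generalizing v with
    | zero => exact ⟨v, h, rfl⟩
    | succ r ih =>
      rw [nhdBall_succ] at h
      simp only [nhdBall_succ]
      rcases h with h | ⟨w, hw, hwv⟩
      · obtain ⟨u, hu, hv⟩ := ih h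
        exact ⟨u, hu, Or.inl hv⟩
      · obtain ⟨u, hu, hv⟩ := ih hw
        exact ⟨u, hu, Or.inr ⟨w, hv, hwv⟩⟩
  · rintro ⟨u, hu, hv⟩
    exact nhdBall_mono (Set.singleton_subset_iff.2 hu) hv

lemma nhdBall_union : G.nhdBall r (S ∪ T) = G.nhdBall r S ∪ G.nhdBall r T := by
  ext v
  rw [Set.mem_union, mem_nhdBall_iff, mem_nhdBall_iff (S := S), mem_nhdBall_iff (S := T)]
  grind

lemma mem_nhdBall_singleton_comm {u v : V} (h : v ∈ G.nhdBall r {u}) : u ∈ G.nhdBall r {v} := by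
  induction r generalizing v with
  | zero => exact (Set.mem_singleton_iff.1 h).symm
  | succ r ih =>
    rw [nhdBall_succ] at h
    rw [nhdBall_add, nhdBall_one]
    rcases h with h | ⟨w, hw, hwv⟩
    · exact nhdBall_mono subset_closedNhd (ih h)
    · refine nhdBall_mono ?_ (ih hw)
      rintro _ rfl
      exact Or.inr ⟨v, rfl, hwv.symm⟩

lemma ncard_closedNhd_le [Finite V] (hG : ∀ v, (G.neighborSet v).ncard ≤ d) (S : Set V) :
    (G.closedNhd S).ncard ≤ (d + 1) * S.ncard := by
  classical
  have hS : S.Finite := S.toFinite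
  induction S, hS using Set.Finite.induction_on with
  | empty => simp [closedNhd]
  | @insert a S ha hS ih =>
    have hsub : G.closedNhd (insert a S) ⊆ G.closedNhd S ∪ insert a (G.neighborSet a) := by
      rintro v (hv | ⟨u, hu, huv⟩)
      · rcases hv with rfl | hv
        · exact Or.inr (Or.inl rfl)
        · exact Or.inl (Or.inl hv)
      · rcases hu with rfl | hu
        · exact Or.inr (Or.inr huv)
        · exact Or.inl (Or.inr ⟨u, hu, huv⟩)
    have h1 := Set.ncard_le_ncard hsub (Set.toFinite _)
    have h2 := Set.ncard_union_le (G.closedNhd S) (insert a (G.neighborSet a))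
    have h3 := Set.ncard_insert_le a (G.neighborSet a)
    have h4 := hG a
    rw [Set.ncard_insert_of_notMem ha hS]
    nlinarith

lemma ncard_nhdBall_le [Finite V] (hG : ∀ v, (G.neighborSet v).ncard ≤ d) (r : ℕ) (S : Set V) :
    (G.nhdBall r S).ncard ≤ (d + 1) ^ r * S.ncard := by
  induction r with
  | zero => simp [nhdBall_zero]
  | succ r ih =>
    rw [nhdBall_succ, pow_succ']
    calc _ ≤ (d + 1) * (G.nhdBall r S).ncard := ncard_closedNhd_le hG _
      _ ≤ (d + 1) * ((d + 1) ^ r * S.ncard) := Nat.mul_le_mul_left _ ih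
      _ = _ := by ring

lemma map_mem_nhdBall {H : SimpleGraph W} (e : G ↪g H) {v : V} (h : v ∈ G.nhdBall r S) :
    e v ∈ H.nhdBall r (e '' S) := by
  induction r generalizing v with
  | zero => exact ⟨v, h, rfl⟩
  | succ r ih =>
    rw [nhdBall_succ] at h ⊢
    rcases h with h | ⟨w, hw, hwv⟩
    · exact Or.inl (ih h)
    · exact Or.inr ⟨e w, ih hw, e.map_adj_iff.2 hwv⟩

end Balls

/-- `R` is the graph of a partial isomorphism from `G` to `H`. -/
def IsPartialIso (G : SimpleGraph V) (H : SimpleGraph W) (R : V → W → Prop) : Prop :=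
  ∀ ⦃v w v' w'⦄, R v w → R v' w' → ((v = v' ↔ w = w') ∧ (G.Adj v v' ↔ H.Adj w w'))

/-- The relation `R` is a partial isomorphism that sends `a` to `b`, is defined on the `r`-ball
around `a`, and covers the `r`-ball around `b`. -/
structure IsLocalIso (r : ℕ) (G : SimpleGraph V) (a : ι → V) (H : SimpleGraph W) (b : ι → W)
    (R : V → W → Prop) : Prop where
  isPartialIso : G.IsPartialIso H R
  exists_right : ∀ v ∈ G.nhdBall r (Set.range a), ∃ w, R v w
  exists_left : ∀ w ∈ H.nhdBall r (Set.range b), ∃ v, R v w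
  center : ∀ i, R (a i) (b i)

/-- The `r`-balls around the tuples `a` and `b` are isomorphic. -/
def LocalIso (r : ℕ) (G : SimpleGraph V) (a : ι → V) (H : SimpleGraph W) (b : ι → W) : Prop :=
  ∃ R, IsLocalIso r G a H b R

/-- The `r`-balls around the vertices `v` and `w` are isomorphic. -/
abbrev LocalIsoAt (r : ℕ) (G : SimpleGraph V) (v : V) (H : SimpleGraph W) (w : W) : Prop :=
  LocalIso r G (fun _ : Unit => v) H (fun _ : Unit => w)

section LocalIso

variable {G : SimpleGraph V} {H : SimpleGraph W} {K : SimpleGraph U} {r s : ℕ}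
  {a : ι → V} {b : ι → W} {c : ι → U} {R : V → W → Prop}

lemma IsPartialIso.flip (h : G.IsPartialIso H R) : H.IsPartialIso G (fun w v => R v w) :=
  fun _ _ _ _ h1 h2 => ⟨(h h1 h2).1.symm, (h h1 h2).2.symm⟩

lemma IsLocalIso.flip (h : IsLocalIso r G a H b R) :
    IsLocalIso r H b G a (fun w v => R v w) :=
  ⟨h.isPartialIso.flip, h.exists_left, h.exists_right, h.center⟩

lemma LocalIso.symm (h : LocalIso r G a H b) : LocalIso r H b G a :=
  let ⟨_, hR⟩ := h
  ⟨_, hR.flip⟩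

lemma IsLocalIso.mono (h : IsLocalIso r G a H b R) (hs : s ≤ r) : IsLocalIso s G a H b R :=
  ⟨h.isPartialIso, fun v hv => h.exists_right v (nhdBall_mono_radius hs hv),
    fun w hw => h.exists_left w (nhdBall_mono_radius hs hw), h.center⟩

lemma LocalIso.mono (h : LocalIso r G a H b) (hs : s ≤ r) : LocalIso s G a H b :=
  let ⟨_, hR⟩ := h
  ⟨_, hR.mono hs⟩

lemma IsLocalIso.mem_nhdBall (h : IsLocalIso r G a H b R) (hs : s ≤ r) {v : V} {w : W}
    (hvw : R v w) (hv : v ∈ G.nhdBall s (Set.range a)) : w ∈ H.nhdBall s (Set.range b) := by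
  induction s generalizing v w with
  | zero =>
    obtain ⟨i, rfl⟩ := hv
    exact ⟨i, (h.isPartialIso (h.center i) hvw).1.1 rfl⟩
  | succ s ih =>
    rw [nhdBall_succ] at hv ⊢
    rcases hv with hv | ⟨u, hu, huv⟩
    · exact Or.inl (ih (by omega) hvw hv)
    · obtain ⟨u', hu'⟩ := h.exists_right u (nhdBall_mono_radius (by omega) hu)
      exact Or.inr ⟨u', ih (by omega) hu' hu, (h.isPartialIso hu' hvw).2.1 huv⟩

lemma IsLocalIso.mem_nhdBall_iff (h : IsLocalIso r G a H b R) (hs : s ≤ r) {v : V} {w : W}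
    (hvw : R v w) : v ∈ G.nhdBall s (Set.range a) ↔ w ∈ H.nhdBall s (Set.range b) :=
  ⟨h.mem_nhdBall hs hvw, h.flip.mem_nhdBall hs hvw⟩

lemma LocalIso.trans (h : LocalIso r G a H b) (h' : LocalIso r H b K c) :
    LocalIso r G a K c := by
  obtain ⟨R, hR⟩ := h
  obtain ⟨R', hR'⟩ := h'
  refine ⟨fun v u => ∃ w, R v w ∧ R' w u, ?_, ?_, ?_, fun i => ⟨b i, hR.center i, hR'.center i⟩⟩
  · rintro v u v' u' ⟨w, h1, h2⟩ ⟨w', h3, h4⟩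
    exact ⟨(hR.isPartialIso h1 h3).1.trans (hR'.isPartialIso h2 h4).1,
      (hR.isPartialIso h1 h3).2.trans (hR'.isPartialIso h2 h4).2⟩
  · intro v hv
    obtain ⟨w, hw⟩ := hR.exists_right v hv
    obtain ⟨u, hu⟩ := hR'.exists_right w (hR.mem_nhdBall le_rfl hw hv)
    exact ⟨u, w, hw, hu⟩
  · intro u hu
    obtain ⟨w, hw⟩ := hR'.exists_left u hu
    obtain ⟨v, hv⟩ := hR.exists_left w (hR'.flip.mem_nhdBall le_rfl hw hu)
    exact ⟨v, w, hv, hw⟩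

lemma localIso_embedding (e : G ↪g H) {v : V} (h : H.nhdBall r {e v} ⊆ Set.range e) :
    LocalIsoAt r G v H (e v) := by
  refine ⟨fun x y => e x = y, ?_, fun x _ => ⟨_, rfl⟩, ?_, fun _ => rfl⟩
  · rintro x _ x' _ rfl rfl
    exact ⟨e.injective.eq_iff.symm, e.map_adj_iff.symm⟩
  · intro y hy
    rw [Set.range_const] at hy
    exact h hy

lemma localIso_embedding_of_closed (e : G ↪g H)
    (h : ∀ x y, H.Adj (e x) y → y ∈ Set.range e) (v : V) : LocalIsoAt r G v H (e v) := by
  refine localIso_embedding e ?_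
  induction r with
  | zero => rintro _ rfl; exact ⟨v, rfl⟩
  | succ r ih =>
    rw [nhdBall_succ]
    rintro y (hy | ⟨z, hz, hzy⟩)
    · exact ih hy
    · obtain ⟨x, rfl⟩ := ih hz
      exact h x y hzy

end LocalIso

/-- Every ball type of radius `r` occurs equally often in `G` and `H`, or at least `t` times in
both. -/
def HanfEquiv (r t : ℕ) (G : SimpleGraph V) (H : SimpleGraph W) : Prop :=
  ∀ (U : Type) (K : SimpleGraph U) (u : U),
    (t ≤ {v | LocalIsoAt r G v K u}.ncard ∧ t ≤ {w | LocalIsoAt r H w K u}.ncard) ∨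
      {v | LocalIsoAt r G v K u}.ncard = {w | LocalIsoAt r H w K u}.ncard

section Hanf

variable {G : SimpleGraph V} {H : SimpleGraph W} {r t d n : ℕ}

lemma HanfEquiv.symm (h : HanfEquiv r t G H) : HanfEquiv r t H G := fun U K u =>
  (h U K u).imp And.symm Eq.symm

lemma HanfEquiv.mono {t' : ℕ} (h : HanfEquiv r t G H) (ht : t' ≤ t) : HanfEquiv r t' G H :=
  fun U K u => (h U K u).imp (And.imp ht.trans ht.trans) id

lemma range_snoc (a : Fin n → V) (x : V) :
    Set.range (Fin.snoc a x : Fin (n + 1) → V) = Set.range a ∪ {x} := by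
  rw [Fin.range_snoc, Set.union_singleton]

lemma nhdBall_singleton_subset {S : Set V} {s : ℕ} {x : V} (hx : x ∈ G.nhdBall s S) :
    G.nhdBall r {x} ⊆ G.nhdBall (r + s) S := by
  rw [nhdBall_add]
  exact nhdBall_mono (Set.singleton_subset_iff.2 hx)

/-- A vertex adjacent or equal to both balls forces the centers to be close. -/
lemma not_mem_closedNhd_of_far {S : Set V} {x : V} (hx : x ∉ G.nhdBall (2 * r + 1) S) {v v' : V}
    (hv : v ∈ G.nhdBall r S) (hv' : v' ∈ G.nhdBall r {x}) : v ≠ v' ∧ ¬ G.Adj v v' := by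
  have key : v' ∉ G.nhdBall (r + 1) S := fun h => hx <| by
    have := nhdBall_singleton_subset (r := r) h (mem_nhdBall_singleton_comm hv')
    rwa [← add_assoc, ← two_mul] at this
  rw [nhdBall_succ] at key
  exact ⟨fun h => key (Or.inl (h ▸ hv)), fun h => key (Or.inr ⟨v, hv, h⟩)⟩

/-- The matching step of the Ehrenfeucht–Fraïssé game. -/
lemma LocalIso.exists_snoc [Finite V] [Finite W] (hG : ∀ v, (G.neighborSet v).ncard ≤ d)
    (ht : (d + 1) ^ (2 * r + 1) * n < t) (hGH : HanfEquiv r t G H) {a : Fin n → V}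
    {b : Fin n → W} (h : LocalIso (3 * r + 1) G a H b) (y : W) :
    ∃ x, LocalIso r G (Fin.snoc a x : Fin (n + 1) → V) H (Fin.snoc b y) := by
  obtain ⟨R, hR⟩ := h
  have hball : r + (2 * r + 1) = 3 * r + 1 := by omega
  have hcenter : ∀ {x y}, R x y → ∀ i, R ((Fin.snoc a x : Fin (n + 1) → V) i)
      ((Fin.snoc b y : Fin (n + 1) → W) i) := by
    intro x y hxy i
    induction i using Fin.lastCases with
    | last => simpa using hxy
    | cast i => simpa using hR.center i
  by_cases hy : y ∈ H.nhdBall (2 * r + 1) (Set.range b)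
  · obtain ⟨x, hx⟩ := hR.exists_left y (nhdBall_mono_radius (by omega) hy)
    have hxa := (hR.mem_nhdBall_iff (by omega) hx).2 hy
    refine ⟨x, R, hR.isPartialIso, fun v hv => hR.exists_right v ?_,
      fun w hw => hR.exists_left w ?_, hcenter hx⟩
    · rw [range_snoc, nhdBall_union] at hv
      rcases hv with hv | hv
      · exact nhdBall_mono_radius (by omega) hv
      · exact hball ▸ nhdBall_singleton_subset hxa hv
    · rw [range_snoc, nhdBall_union] at hw
      rcases hw with hw | hw
      · exact nhdBall_mono_radius (by omega) hw
      · exact hball ▸ nhdBall_singleton_subset hy hw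
  · obtain ⟨x, hxy, hx⟩ : ∃ x, LocalIsoAt r G x H y ∧ x ∉ G.nhdBall (2 * r + 1) (Set.range a) := by
      by_contra! hcon
      have hsub : {v | LocalIsoAt r G v H y} ⊆ G.nhdBall (2 * r + 1) (Set.range a) := hcon
      rcases hGH W H y with ⟨h1, -⟩ | h1
      · have h2 := Set.ncard_le_ncard hsub (Set.toFinite _)
        have h3 := ncard_nhdBall_le hG (2 * r + 1) (Set.range a)
        have h4 : (Set.range a).ncard ≤ n := by
          rw [← Set.image_univ]
          exact (Set.ncard_image_le Set.finite_univ).trans (by simp [Set.ncard_univ])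
        have h5 := Nat.mul_le_mul_left ((d + 1) ^ (2 * r + 1)) h4
        omega
      · have hyy : y ∈ {w | LocalIsoAt r H w H y} :=
          localIso_embedding_of_closed (Embedding.refl) (fun x y _ => ⟨y, rfl⟩) y
        have hex : ∀ v ∈ {v | LocalIsoAt r G v H y}, ∃ w, R v w := fun v hv =>
          hR.exists_right v (nhdBall_mono_radius (by omega) (hsub hv))
        have : Nonempty W := ⟨y⟩
        choose! f hf using hex
        have hle : {v | LocalIsoAt r G v H y}.ncard ≤ ({w | LocalIsoAt r H w H y} \ {y}).ncard := by
          refine Set.ncard_le_ncard_of_injOn f ?_ ?_ (Set.toFinite _)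
          · intro v hv
            have hfv := (hR.mem_nhdBall_iff (by omega) (hf v hv)).1 (hsub hv)
            refine ⟨LocalIso.trans (LocalIso.symm ⟨R, hR.isPartialIso, ?_, ?_, ?_⟩) hv, ?_⟩
            · intro z hz
              rw [Set.range_const] at hz
              exact hR.exists_right z (hball ▸ nhdBall_singleton_subset (hsub hv) hz)
            · intro z hz
              rw [Set.range_const] at hz
              exact hR.exists_left z (hball ▸ nhdBall_singleton_subset hfv hz)
            · exact fun _ => hf v hv
            · rintro rfl
              exact hy hfv
          · intro v hv v' hv' hvv'
            exact (hR.isPartialIso (hf v hv) (hf v' hv')).1.2 hvv'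
        have := Set.ncard_sdiff_singleton_lt_of_mem hyy (Set.toFinite _)
        omega
    obtain ⟨R', hR'⟩ := hxy
    have hR0 : IsLocalIso r G a H b R := hR.mono (by omega)
    have hR'G : ∀ {v w}, R' v w → (v ∈ G.nhdBall r {x} ↔ w ∈ H.nhdBall r {y}) := by
      intro v w hvw
      simpa only [Set.range_const] using hR'.mem_nhdBall_iff le_rfl hvw
    refine ⟨x, fun v w => (R v w ∧ v ∈ G.nhdBall r (Set.range a)) ∨
      (R' v w ∧ v ∈ G.nhdBall r {x}), ?_, ?_, ?_, ?_⟩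
    · rintro v w v' w' (⟨h1, h2⟩ | ⟨h1, h2⟩) (⟨h3, h4⟩ | ⟨h3, h4⟩)
      · exact hR.isPartialIso h1 h3
      · have hG' := not_mem_closedNhd_of_far hx h2 h4
        have hH' := not_mem_closedNhd_of_far hy ((hR0.mem_nhdBall_iff le_rfl h1).1 h2)
          ((hR'G h3).1 h4)
        exact ⟨iff_of_false hG'.1 hH'.1, iff_of_false hG'.2 hH'.2⟩
      · have hG' := not_mem_closedNhd_of_far hx h4 h2
        have hH' := not_mem_closedNhd_of_far hy ((hR0.mem_nhdBall_iff le_rfl h3).1 h4)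
          ((hR'G h1).1 h2)
        exact ⟨iff_of_false hG'.1.symm hH'.1.symm,
          iff_of_false (fun h => hG'.2 h.symm) (fun h => hH'.2 h.symm)⟩
      · exact hR'.isPartialIso h1 h3
    · intro v hv
      rw [range_snoc, nhdBall_union] at hv
      rcases hv with hv | hv
      · obtain ⟨w, hw⟩ := hR0.exists_right v hv
        exact ⟨w, Or.inl ⟨hw, hv⟩⟩
      · obtain ⟨w, hw⟩ := hR'.exists_right v (by rwa [Set.range_const])
        exact ⟨w, Or.inr ⟨hw, hv⟩⟩
    · intro w hw
      rw [range_snoc, nhdBall_union] at hw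
      rcases hw with hw | hw
      · obtain ⟨v, hv⟩ := hR0.exists_left w hw
        exact ⟨v, Or.inl ⟨hv, (hR0.mem_nhdBall_iff le_rfl hv).2 hw⟩⟩
      · obtain ⟨v, hv⟩ := hR'.exists_left w (by rwa [Set.range_const])
        exact ⟨v, Or.inr ⟨hv, (hR'G hv).2 hw⟩⟩
    · intro i
      induction i using Fin.lastCases with
      | last => simpa using Or.inr ⟨hR'.center (), subset_nhdBall rfl⟩
      | cast i => simpa using Or.inl ⟨hR.center i, subset_nhdBall ⟨i, rfl⟩⟩

end Hanf

end SimpleGraph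

namespace SimpleGraph

variable {V W : Type}

/-- The graph `G`, or its complement if `c` is `true`. -/
def twist (c : Bool) (G : SimpleGraph V) : SimpleGraph V := bif c then Gᶜ else G

lemma twist_adj_congr {G : SimpleGraph V} {H : SimpleGraph W} {v v' : V} {w w' : W}
    (heq : v = v' ↔ w = w') (hadj : G.Adj v v' ↔ H.Adj w w') (c : Bool) :
    (G.twist c).Adj v v' ↔ (H.twist c).Adj w w' := by
  cases c
  · exact hadj
  · simp only [twist, cond_true, compl_adj, ne_eq, heq, hadj]

/-- An embedding of graphs is an embedding of the (complemented) graphs. -/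
def Embedding.twist {G : SimpleGraph V} {H : SimpleGraph W} (e : G ↪g H) (c : Bool) :
    G.twist c ↪g H.twist c where
  toEmbedding := e.toEmbedding
  map_rel_iff' := twist_adj_congr e.injective.eq_iff e.map_adj_iff c

lemma term_realize_eq {n : ℕ} (t : Language.graph.Term (Empty ⊕ Fin n)) :
    ∃ i, ∀ (V : Type) (G : SimpleGraph V) (v : Empty → V) (a : Fin n → V),
      @Term.realize Language.graph V G.structure _ (Sum.elim v a) t = a i := by
  rcases t with (x | i) | ⟨f, _⟩
  · exact x.elim
  · exact ⟨i, fun _ _ _ _ => rfl⟩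
  · exact isEmptyElim f

/-- A form of Hanf's locality theorem for graphs of bounded degree and their complements. -/
theorem exists_realize_iff_of_hanfEquiv (d : ℕ) {n : ℕ}
    (φ : Language.graph.BoundedFormula Empty n) :
    ∃ r t : ℕ, ∀ (V W : Type) [Finite V] [Finite W] (G : SimpleGraph V) (H : SimpleGraph W),
      (∀ v, (G.neighborSet v).ncard ≤ d) → (∀ w, (H.neighborSet w).ncard ≤ d) →
      (∀ s ≤ r, HanfEquiv s t G H) → ∀ (v : Empty → V) (w : Empty → W) (a : Fin n → V)
        (b : Fin n → W), LocalIso r G a H b → ∀ c : Bool,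
        (@BoundedFormula.Realize Language.graph V (G.twist c).structure _ _ φ v a ↔
          @BoundedFormula.Realize Language.graph W (H.twist c).structure _ _ φ w b) := by
  induction φ with
  | falsum => exact ⟨0, 0, fun _ _ _ _ _ _ _ _ _ _ _ _ _ _ _ => Iff.rfl⟩
  | equal t₁ t₂ =>
    obtain ⟨i, hi⟩ := term_realize_eq t₁
    obtain ⟨j, hj⟩ := term_realize_eq t₂
    refine ⟨0, 0, fun V W _ _ G H _ _ _ v w a b ⟨R, hR⟩ c => ?_⟩
    simp only [BoundedFormula.Realize, hi, hj]
    exact (hR.isPartialIso (hR.center i) (hR.center j)).1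
  | rel R ts =>
    cases R
    obtain ⟨i, hi⟩ := term_realize_eq (ts 0)
    obtain ⟨j, hj⟩ := term_realize_eq (ts 1)
    refine ⟨0, 0, fun V W _ _ G H _ _ _ v w a b ⟨R, hR⟩ c => ?_⟩
    simp only [BoundedFormula.Realize]
    change (G.twist c).Adj _ _ ↔ (H.twist c).Adj _ _
    simp only [hi, hj]
    have := hR.isPartialIso (hR.center i) (hR.center j)
    exact twist_adj_congr this.1 this.2 c
  | imp φ ψ ihφ ihψ =>
    obtain ⟨r₁, t₁, h₁⟩ := ihφ
    obtain ⟨r₂, t₂, h₂⟩ := ihψ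
    refine ⟨max r₁ r₂, max t₁ t₂, fun V W _ _ G H hG hH hGH v w a b hab c => ?_⟩
    exact imp_congr
      (h₁ V W G H hG hH (fun s hs => (hGH s (hs.trans (le_max_left _ _))).mono (le_max_left _ _))
        v w a b (hab.mono (le_max_left _ _)) c)
      (h₂ V W G H hG hH (fun s hs => (hGH s (hs.trans (le_max_right _ _))).mono (le_max_right _ _))
        v w a b (hab.mono (le_max_right _ _)) c)
  | @all n φ ih =>
    obtain ⟨r, t, h⟩ := ih
    have hlt : (d + 1) ^ (2 * r + 1) * n < max t ((d + 1) ^ (2 * r + 1) * n + 1) :=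
      (Nat.lt_succ_self _).trans_le (le_max_right _ _)
    refine ⟨3 * r + 1, max t ((d + 1) ^ (2 * r + 1) * n + 1),
      fun V W _ _ G H hG hH hGH v w a b hab c => ?_⟩
    have hGH' : ∀ s ≤ r, HanfEquiv s t G H := fun s hs =>
      (hGH s (by omega)).mono (le_max_left _ _)
    constructor
    · intro hall y
      obtain ⟨x, hx⟩ := hab.exists_snoc hG hlt (hGH r (by omega)) y
      exact (h V W G H hG hH hGH' v w _ _ hx c).1 (hall x)
    · intro hall x
      obtain ⟨y, hy⟩ := hab.symm.exists_snoc hH hlt (hGH r (by omega)).symm x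
      exact (h V W G H hG hH hGH' v w _ _ hy.symm c).2 (hall y)

end SimpleGraph

namespace SimpleGraph

variable {V W U : Type}

/-- The graph `K` embeds into `G` outside of any set of at most `f` vertices. -/
def IsFrequent (K : SimpleGraph U) (G : SimpleGraph V) (f : ℕ) : Prop :=
  ∀ Z : Set V, Z.ncard ≤ f → ∃ e : K ↪g G, ∀ x, e x ∉ Z

lemma IsFrequent.mono {K : SimpleGraph U} {G : SimpleGraph V} {f f' : ℕ}
    (h : IsFrequent K G f') (hf : f ≤ f') : IsFrequent K G f := fun Z hZ => h Z (hZ.trans hf)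

/-- Finitely many descending properties of natural numbers have a common gap `[f, F f]`, bounded
in terms of `F` only. -/
lemma exists_common_gap (κ : Type) [Finite κ] (F : ℕ → ℕ) :
    ∃ N, ∀ p : κ → ℕ → Prop, (∀ k f f', f ≤ f' → p k f' → p k f) →
      ∃ f ≤ N, ∀ k, p k f → p k (F f) := by
  suffices H : ∀ m f₀ : ℕ, ∃ N, ∀ p : κ → ℕ → Prop, (∀ k f f', f ≤ f' → p k f' → p k f) →
      {k | p k f₀}.ncard ≤ m → ∃ f ≤ N, ∀ k, p k f → p k (F f) by
    obtain ⟨N, hN⟩ := H (Nat.card κ) 0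
    exact ⟨N, fun p hp => hN p hp (Set.ncard_le_card _)⟩
  intro m
  induction m with
  | zero =>
    refine fun f₀ => ⟨f₀, fun p _ h0 => ⟨f₀, le_rfl, fun k hk => ?_⟩⟩
    have := (Set.ncard_eq_zero (Set.toFinite _)).1 (Nat.le_zero.1 h0)
    exact absurd hk (Set.eq_empty_iff_forall_notMem.1 this k)
  | succ m ih =>
    intro f₀
    obtain ⟨N, hN⟩ := ih (max f₀ (F f₀))
    refine ⟨max f₀ N, fun p hp hcard => ?_⟩
    by_cases hgood : ∀ k, p k f₀ → p k (F f₀)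
    · exact ⟨f₀, le_max_left _ _, hgood⟩
    · push Not at hgood
      obtain ⟨k, hk, hk'⟩ := hgood
      have hlt : {k | p k (max f₀ (F f₀))}.ncard < {k | p k f₀}.ncard := by
        refine Set.ncard_lt_ncard ⟨fun j hj => hp j _ _ (le_max_left _ _) hj, fun hsub => ?_⟩
          (Set.toFinite _)
        exact hk' (hp k _ _ (le_max_right _ _) (hsub hk))
      obtain ⟨f, hf, h⟩ := hN p hp (by omega)
      exact ⟨f, hf.trans (le_max_right _ _), h⟩

lemma not_mem_closedNhd_range_comm {A B : Type} {G : SimpleGraph V} {e : A → V} {e' : B → V}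
    (h : ∀ x, e x ∉ G.closedNhd (Set.range e')) (y : B) :
    e' y ∉ G.closedNhd (Set.range e) := by
  rintro (⟨x, hx⟩ | ⟨_, ⟨x, rfl⟩, hadj⟩)
  · exact h x (Or.inl ⟨y, hx.symm⟩)
  · exact h x (Or.inr ⟨_, ⟨y, rfl⟩, hadj.symm⟩)

/-- Frequent graphs can be embedded pairwise apart, and apart from a given set. -/
lemma exists_apart_embeddings {ι : Type} [Finite ι] {A : ι → Type} [∀ i, Finite (A i)]
    {K : ∀ i, SimpleGraph (A i)} [Finite V] {G : SimpleGraph V} {d B : ℕ}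
    (hG : ∀ v, (G.neighborSet v).ncard ≤ d) (hA : ∀ i, Nat.card (A i) ≤ B) (X : Set V)
    (hfreq : ∀ i, IsFrequent (K i) G ((d + 1) * (X.ncard + Nat.card ι * B))) :
    ∃ e : ∀ i, K i ↪g G, (∀ i x, e i x ∉ G.closedNhd X) ∧
      ∀ i j, i ≠ j → ∀ x, e i x ∉ G.closedNhd (Set.range (e j)) := by
  classical
  have := Fintype.ofFinite ι
  suffices H : ∀ s : Finset ι, ∃ e : ∀ i, K i ↪g G, (∀ i ∈ s, ∀ x, e i x ∉ G.closedNhd X) ∧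
      ∀ i ∈ s, ∀ j ∈ s, i ≠ j → ∀ x, e i x ∉ G.closedNhd (Set.range (e j)) by
    simpa using H Finset.univ
  intro s
  induction s using Finset.induction_on with
  | empty =>
    choose e _ using fun i => hfreq i ∅ (by simp)
    exact ⟨e, by simp, by simp⟩
  | @insert k s hk ih =>
    obtain ⟨e, he, hee⟩ := ih
    have hcard : (X ∪ ⋃ i ∈ s, Set.range (e i)).ncard ≤ X.ncard + Nat.card ι * B := by
      refine (Set.ncard_union_le _ _).trans (Nat.add_le_add_left ?_ _)
      refine (Finset.set_ncard_biUnion_le _ _).trans ?_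
      refine (Finset.sum_le_card_nsmul s _ B fun i _ => ?_).trans ?_
      · rw [← Nat.card_coe_set_eq, Nat.card_range_of_injective (e i).injective]
        exact hA i
      · rw [smul_eq_mul, Nat.card_eq_fintype_card]
        exact Nat.mul_le_mul_right _ (Finset.card_le_univ s)
    obtain ⟨f, hf⟩ := hfreq k (G.closedNhd (X ∪ ⋃ i ∈ s, Set.range (e i)))
      ((ncard_closedNhd_le hG _).trans (Nat.mul_le_mul_left _ hcard))
    have hfe : ∀ j ∈ s, ∀ x, f x ∉ G.closedNhd (Set.range (e j)) := fun j hj x hx =>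
      hf x (closedNhd_mono (Set.subset_union_of_subset_right
        (Set.subset_biUnion_of_mem (u := fun i => Set.range (e i)) hj) _) hx)
    have hne : ∀ j ∈ s, j ≠ k := fun j hj h => hk (h ▸ hj)
    refine ⟨Function.update e k f, fun i hi => ?_, fun i hi j hj hij => ?_⟩
    · rcases Finset.mem_insert.1 hi with rfl | hi
      · rw [Function.update_self]
        exact fun x hx => hf x (closedNhd_mono Set.subset_union_left hx)
      · rw [Function.update_of_ne (hne i hi)]
        exact he i hi
    · rcases Finset.mem_insert.1 hi with rfl | his <;> rcases Finset.mem_insert.1 hj with rfl | hjs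
      · exact absurd rfl hij
      · rw [Function.update_self, Function.update_of_ne (hne j hjs)]
        exact hfe j hjs
      · rw [Function.update_self, Function.update_of_ne (hne i his)]
        exact not_mem_closedNhd_range_comm (hfe i his)
      · rw [Function.update_of_ne (hne j hjs), Function.update_of_ne (hne i his)]
        exact hee i his j hjs hij

/-- The ball around a vertex is isomorphic to a graph on an initial segment of the naturals. -/
lemma exists_fin_localIsoAt [Finite V] (G : SimpleGraph V) (s : ℕ) (v : V) :
    ∃ (n : ℕ) (K : SimpleGraph (Fin n)) (x : Fin n) (e : K ↪g G),
      n = (G.nhdBall s {v}).ncard ∧ Set.range e = G.nhdBall s {v} ∧ LocalIsoAt s K x G v := by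
  have := Fintype.ofFinite (G.nhdBall s {v})
  let g := (G.induce (G.nhdBall s {v})).overFinIso rfl
  let e := g.symm.toEmbedding.trans (Embedding.induce (G.nhdBall s {v}))
  have hrange : Set.range e = G.nhdBall s {v} := by
    change Set.range (Subtype.val ∘ g.symm) = _
    rw [g.symm.surjective.range_comp, Subtype.range_coe]
  obtain ⟨x, hx⟩ : v ∈ Set.range e := by
    rw [hrange]
    exact subset_nhdBall rfl
  refine ⟨_, _, x, e, ?_, hrange, ?_⟩
  · rw [← Nat.card_coe_set_eq, Nat.card_eq_fintype_card]
  · have hloc : LocalIsoAt s _ x G (e x) := localIso_embedding e (by rw [hrange, hx])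
    rwa [hx] at hloc

/-- Every graph of bounded degree has an induced subgraph of bounded size which cannot be
distinguished locally from some disjoint extension of the whole graph. -/
theorem exists_hanfEquiv_induce (d r t : ℕ) :
    ∃ N, ∀ (V : Type) [Finite V] (G : SimpleGraph V), (∀ v, (G.neighborSet v).ncard ≤ d) →
      ∃ S Y : Set V, S.ncard ≤ N ∧ ∀ s ≤ r, HanfEquiv s t (G.induce S) (G ⊕g G.induce Y) := by
  classical
  let B := (d + 1) ^ r
  let κ := Σ n : Fin (B + 1), SimpleGraph (Fin n)
  let LX : ℕ → ℕ := fun f => (d + 1) ^ (2 * r) * (Nat.card κ * f)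
  let LY : ℕ := Nat.card κ * t * B
  obtain ⟨N, hN⟩ := exists_common_gap κ fun f => (d + 1) * (LX f + LY)
  refine ⟨LX N + LY, fun V _ G hG => ?_⟩
  obtain ⟨f, hfN, hf⟩ := hN (fun k f => IsFrequent k.2 G f) fun k f f' hff' h => h.mono hff'
  have hZ : ∀ k : κ, ∃ Z : Set V, Z.ncard ≤ f ∧
      (¬ IsFrequent k.2 G f → ∀ e : k.2 ↪g G, ∃ x, e x ∈ Z) := by
    intro k
    by_cases hk : IsFrequent k.2 G f
    · exact ⟨∅, by simp, fun h => absurd hk h⟩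
    · have hk' := hk
      unfold IsFrequent at hk'
      push Not at hk'
      obtain ⟨Z, hZ, h⟩ := hk'
      exact ⟨Z, hZ, fun _ => h⟩
  choose Z hZcard hZ using hZ
  have := Fintype.ofFinite κ
  let X₀ : Set V := ⋃ k, Z k
  let X : Set V := G.nhdBall (2 * r) X₀
  have hX₀ : X₀.ncard ≤ Nat.card κ * f := by
    have h1 : X₀.ncard ≤ ∑ k : κ, (Z k).ncard := by
      have := Finset.set_ncard_biUnion_le (Finset.univ : Finset κ) Z
      simpa [X₀] using this
    refine h1.trans ((Finset.sum_le_card_nsmul _ _ f fun k _ => hZcard k).trans ?_)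
    rw [smul_eq_mul, Nat.card_eq_fintype_card, Finset.card_univ]
  have hX : X.ncard ≤ LX f :=
    (ncard_nhdBall_le hG _ _).trans (Nat.mul_le_mul_left _ hX₀)
  let ι := {k : κ // IsFrequent k.2 G f} × Fin t
  have hι : Nat.card ι ≤ Nat.card κ * t := by
    rw [Nat.card_prod, Nat.card_eq_fintype_card (α := Fin t), Fintype.card_fin]
    exact Nat.mul_le_mul_right _ (Finite.card_subtype_le _)
  have hsize : ∀ i : ι, Nat.card (Fin i.1.1.1) ≤ B := fun i => by
    rw [Nat.card_eq_fintype_card, Fintype.card_fin]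
    exact Nat.lt_succ_iff.1 i.1.1.1.2
  obtain ⟨e, heX, hee⟩ := exists_apart_embeddings (K := fun i : ι => i.1.1.2) hG hsize X
    fun i => (hf i.1.1 i.1.2).mono <| Nat.mul_le_mul_left _ <|
      Nat.add_le_add hX (Nat.mul_le_mul_right _ hι)
  have := Fintype.ofFinite ι
  let Y : Set V := ⋃ i, Set.range (e i)
  have hY : Y.ncard ≤ LY := by
    have h1 : Y.ncard ≤ ∑ i : ι, (Set.range (e i)).ncard := by
      have := Finset.set_ncard_biUnion_le (Finset.univ : Finset ι) fun i => Set.range (e i)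
      simpa [Y] using this
    refine h1.trans ((Finset.sum_le_card_nsmul _ _ B fun i _ => ?_).trans ?_)
    · rw [← Nat.card_coe_set_eq, Nat.card_range_of_injective (e i).injective]
      exact hsize i
    · rw [smul_eq_mul, Finset.card_univ, ← Nat.card_eq_fintype_card]
      exact Nat.mul_le_mul_right _ hι
  refine ⟨X ∪ Y, Y, (Set.ncard_union_le _ _).trans (Nat.add_le_add (hX.trans ?_) hY),
    fun s hs U K u => ?_⟩
  · exact Nat.mul_le_mul_left _ (Nat.mul_le_mul_left _ hfN)
  have hmemY : ∀ i x, e i x ∈ Y := fun i x => Set.mem_iUnion.2 ⟨i, x, rfl⟩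
  -- the copies of the frequent graphs are unions of components of both graphs
  have hclosedY : ∀ i x y, y ∈ Y → G.Adj (e i x) y → y ∈ Set.range (e i) := by
    intro i x y hy hxy
    obtain ⟨j, hj⟩ := Set.mem_iUnion.1 hy
    by_cases hij : i = j
    · exact hij ▸ hj
    · exact absurd (Or.inr ⟨y, hj, hxy.symm⟩) (hee i j hij x)
  have hclosedS : ∀ i x y, y ∈ X ∪ Y → G.Adj (e i x) y → y ∈ Set.range (e i) := by
    rintro i x y (hy | hy) hxy
    · exact absurd (Or.inr ⟨y, hy, hxy.symm⟩) (heX i x)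
    · exact hclosedY i x y hy hxy
  have hcopyS : ∀ i x, LocalIsoAt s i.1.1.2 x (G.induce (X ∪ Y)) ⟨e i x, Or.inr (hmemY i x)⟩ := by
    intro i x
    let e' : i.1.1.2 ↪g G.induce (X ∪ Y) :=
      ⟨⟨fun x => ⟨e i x, Or.inr (hmemY i x)⟩, fun x y h => (e i).injective (Subtype.ext_iff.1 h)⟩,
        (e i).map_adj_iff⟩
    refine localIso_embedding_of_closed e' (fun x y hxy => ?_) x
    obtain ⟨z, hz⟩ := hclosedS i x y.1 y.2 hxy
    exact ⟨z, Subtype.ext hz⟩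
  have hcopyY : ∀ i x, LocalIsoAt s i.1.1.2 x (G ⊕g G.induce Y) (Sum.inr ⟨e i x, hmemY i x⟩) := by
    intro i x
    let e' : i.1.1.2 ↪g G ⊕g G.induce Y :=
      ⟨⟨fun x => Sum.inr ⟨e i x, hmemY i x⟩, fun x y h =>
        (e i).injective (Subtype.ext_iff.1 (Sum.inr_injective h))⟩, (e i).map_adj_iff⟩
    refine localIso_embedding_of_closed e' (fun x y hxy => ?_) x
    rcases y with y | y
    · exact absurd hxy (by simp [e'])
    · obtain ⟨z, hz⟩ := hclosedY i x y.1 y.2 hxy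
      exact ⟨z, congrArg Sum.inr (Subtype.ext hz)⟩
  -- the type of a vertex far from `X₀` is realized in a frequent graph
  have hfar : ∀ {W : Type} [Finite W] (H : SimpleGraph W) (g : H ↪g G) (w : W),
      g w ∉ G.nhdBall r X₀ → ∃ (k : {k : κ // IsFrequent k.2 G f}) (x : Fin k.1.1),
        LocalIsoAt s k.1.2 x H w := by
    intro W _ H g w hw
    obtain ⟨n, L, x, j, hn, hj, hx⟩ := exists_fin_localIsoAt H s w
    have hsub : ∀ y ∈ H.nhdBall s {w}, g y ∈ G.nhdBall r {g w} := fun y hy => by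
      have := map_mem_nhdBall g hy
      rw [Set.image_singleton] at this
      exact nhdBall_mono_radius hs this
    have hnB : n ≤ B := by
      rw [hn]
      refine (Set.ncard_le_ncard_of_injOn g hsub g.injective.injOn (Set.toFinite _)).trans ?_
      refine (ncard_nhdBall_le hG _ _).trans ?_
      rw [Set.ncard_singleton, mul_one]
    refine ⟨⟨⟨⟨n, Nat.lt_succ_iff.2 hnB⟩, L⟩, ?_⟩, x, hx⟩
    by_contra hrare
    obtain ⟨y, hy⟩ := hZ _ hrare (j.trans g)
    have hy' : g (j y) ∈ G.nhdBall r {g w} := hsub _ (hj ▸ ⟨y, rfl⟩)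
    exact hw (mem_nhdBall_iff.2 ⟨_, Set.mem_iUnion.2 ⟨_, hy⟩, mem_nhdBall_singleton_comm hy'⟩)
  by_cases hU : ∃ (k : {k : κ // IsFrequent k.2 G f}) (x : Fin k.1.1), LocalIsoAt s k.1.2 x K u
  · obtain ⟨k, x, hkx⟩ := hU
    have hinj : Function.Injective fun i : Fin t => e (k, i) x := fun i j hij => by
      by_contra hne
      exact hee (k, i) (k, j) (fun h => hne (Prod.ext_iff.1 h).2) x (Or.inl ⟨x, hij.symm⟩)
    have hcount : ∀ {α : Type} [Finite α] (T : Set α) (g : Fin t → α), Function.Injective g →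
        (∀ i, g i ∈ T) → t ≤ T.ncard := fun T g hg hT => by
      have := Set.ncard_le_ncard (Set.range_subset_iff.2 hT) (Set.toFinite _)
      rwa [← Nat.card_coe_set_eq, Nat.card_range_of_injective hg, Nat.card_eq_fintype_card,
        Fintype.card_fin] at this
    refine Or.inl ⟨hcount _ (fun i => ⟨e (k, i) x, Or.inr (hmemY (k, i) x)⟩) ?_ ?_,
      hcount _ (fun i => Sum.inr ⟨e (k, i) x, hmemY (k, i) x⟩) ?_ ?_⟩
    · exact fun i j hij => hinj (Subtype.ext_iff.1 hij)
    · exact fun i => (hcopyS (k, i) x).symm.trans hkx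
    · exact fun i j hij => hinj (Subtype.ext_iff.1 (Sum.inr_injective hij))
    · exact fun i => (hcopyY (k, i) x).symm.trans hkx
  · have hnear : ∀ v ∈ G.nhdBall r X₀, G.nhdBall s {v} ⊆ X := fun v hv =>
      (nhdBall_singleton_subset hv).trans (nhdBall_mono_radius (by omega))
    have hindS : ∀ v (hv : v ∈ X), v ∈ G.nhdBall r X₀ →
        LocalIsoAt s (G.induce (X ∪ Y)) ⟨v, Or.inl hv⟩ G v := fun v hv hv' =>
      localIso_embedding (Embedding.induce (X ∪ Y)) (by
        intro y hy
        exact ⟨⟨y, Or.inl (hnear v hv' hy)⟩, rfl⟩)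
    have hsum : ∀ v, LocalIsoAt s G v (G ⊕g G.induce Y) (Sum.inl v) := fun v =>
      localIso_embedding_of_closed Embedding.sumInl (by
        rintro x (y | y) hxy
        · exact ⟨y, rfl⟩
        · exact absurd hxy (by simp)) v
    have hY' : ∀ y ∈ Y, ∃ i x, e i x = y := fun y hy => by
      simpa only [Y, Set.mem_iUnion, Set.mem_range] using hy
    refine Or.inr ?_
    let P : Set V := {v | v ∈ G.nhdBall r X₀ ∧ LocalIsoAt s G v K u}
    trans P.ncard
    · rw [← Set.ncard_image_of_injective _ (Subtype.val_injective (p := (· ∈ X ∪ Y)))]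
      congr 1
      ext v
      constructor
      · rintro ⟨⟨v, hv⟩, hvu, rfl⟩
        by_cases hvr : v ∈ G.nhdBall r X₀
        · exact ⟨hvr, (hindS v (nhdBall_mono_radius (by omega) hvr) hvr).symm.trans hvu⟩
        · obtain ⟨k, x, hx⟩ := hfar (G.induce (X ∪ Y)) (Embedding.induce _) ⟨v, hv⟩ hvr
          exact absurd ⟨k, x, hx.trans hvu⟩ hU
      · rintro ⟨hvr, hvu⟩
        have hvX : v ∈ X := nhdBall_mono_radius (by omega) hvr
        exact ⟨⟨v, Or.inl hvX⟩, (hindS v hvX hvr).trans hvu, rfl⟩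
    · rw [← Set.ncard_image_of_injective _ (Sum.inl_injective (β := Y))]
      congr 1
      ext v
      constructor
      · rintro ⟨v, ⟨hvr, hvu⟩, rfl⟩
        exact (hsum v).symm.trans hvu
      · intro hvu
        rcases v with v | ⟨y, hy⟩
        · refine ⟨v, ⟨?_, (hsum v).trans hvu⟩, rfl⟩
          by_contra hvr
          obtain ⟨k, x, hx⟩ := hfar G Embedding.refl v hvr
          exact hU ⟨k, x, hx.trans ((hsum v).trans hvu)⟩
        · obtain ⟨i, x, rfl⟩ := hY' y hy
          exact absurd ⟨i.1, x, (hcopyY i x).trans hvu⟩ hU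

end SimpleGraph

namespace SimpleGraph

variable {V W : Type} {G : SimpleGraph V} {H : SimpleGraph W} {d : ℕ}

lemma ncard_neighborSet_le_of_embedding [Finite W] (e : G ↪g H)
    (hH : ∀ w, (H.neighborSet w).ncard ≤ d) (v : V) : (G.neighborSet v).ncard ≤ d :=
  (Set.ncard_le_ncard_of_injOn e (fun _ hx => e.map_adj_iff.2 hx) e.injective.injOn
    (Set.toFinite _)).trans (hH (e v))

lemma ncard_neighborSet_sum_le (hG : ∀ v, (G.neighborSet v).ncard ≤ d)
    (hH : ∀ w, (H.neighborSet w).ncard ≤ d) (x : V ⊕ W) :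
    ((G ⊕g H).neighborSet x).ncard ≤ d := by
  rcases x with v | w
  · have : (G ⊕g H).neighborSet (Sum.inl v) = Sum.inl '' G.neighborSet v := by
      ext (y | y) <;> simp
    rw [this, Set.ncard_image_of_injective _ Sum.inl_injective]
    exact hG v
  · have : (G ⊕g H).neighborSet (Sum.inr w) = Sum.inr '' H.neighborSet w := by
      ext (y | y) <;> simp
    rw [this, Set.ncard_image_of_injective _ Sum.inr_injective]
    exact hH w

/-- If the truth of `φ` in (complements of) graphs of degree at most `d` is preserved by
embeddings, then every model has an induced submodel of bounded size. -/
theorem exists_bounded_submodel (d : ℕ) (φ : Language.graph.Sentence) (c : Bool)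
    (hpres : ∀ (V W : Type) [Finite V] [Finite W] (G : SimpleGraph V) (H : SimpleGraph W),
      (∀ v, (G.neighborSet v).ncard ≤ d) → (∀ w, (H.neighborSet w).ncard ≤ d) → (G ↪g H) →
        GSat (G.twist c) φ → GSat (H.twist c) φ) :
    ∃ N, ∀ (V : Type) [Finite V] (G : SimpleGraph V), (∀ v, (G.neighborSet v).ncard ≤ d) →
      GSat (G.twist c) φ → ∃ S : Set V, S.ncard ≤ N ∧ GSat ((G.induce S).twist c) φ := by
  obtain ⟨r, t, h⟩ := exists_realize_iff_of_hanfEquiv d φ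
  obtain ⟨N, hN⟩ := exists_hanfEquiv_induce d r t
  refine ⟨N, fun V _ G hG hφ => ?_⟩
  obtain ⟨S, Y, hS, hSY⟩ := hN V G hG
  have hdeg : ∀ T : Set V, ∀ v, ((G.induce T).neighborSet v).ncard ≤ d := fun T =>
    ncard_neighborSet_le_of_embedding (Embedding.induce T) hG
  have hdeg' := ncard_neighborSet_sum_le hG (hdeg Y)
  refine ⟨S, hS, ?_⟩
  refine (h _ _ _ _ (hdeg S) hdeg' hSY default default default default
    ⟨fun _ _ => False, ?_, ?_, ?_, fun i => i.elim0⟩ c).2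
      (hpres _ _ _ _ hG hdeg' Embedding.sumInl hφ)
  · exact fun _ _ _ _ h => h.elim
  · intro v hv
    obtain ⟨_, ⟨i, _⟩, _⟩ := mem_nhdBall_iff.1 hv
    exact i.elim0
  · intro v hv
    obtain ⟨_, ⟨i, _⟩, _⟩ := mem_nhdBall_iff.1 hv
    exact i.elim0

end SimpleGraph

namespace FirstOrder.Language.BoundedFormula

variable {L : Language} {α β : Type} {n : ℕ}

lemma IsQF.iSup [Finite β] {f : β → L.BoundedFormula α n} (h : ∀ b, (f b).IsQF) :
    (BoundedFormula.iSup f).IsQF := by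
  suffices H : ∀ l : List β, ((l.map f).foldr (· ⊔ ·) ⊥).IsQF from H _
  intro l
  induction l with
  | nil => exact isQF_bot
  | cons b l ih => exact (h b).sup ih

lemma IsQF.iInf [Finite β] {f : β → L.BoundedFormula α n} (h : ∀ b, (f b).IsQF) :
    (BoundedFormula.iInf f).IsQF := by
  suffices H : ∀ l : List β, ((l.map f).foldr (· ⊓ ·) ⊤).IsQF from H _
  intro l
  induction l with
  | nil => exact IsQF.top
  | cons b l ih => exact (h b).inf ih

end FirstOrder.Language.BoundedFormula

section Diagram

open scoped Classical in
/-- The formula `θ` or its negation, according to the truth value of `p`. -/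
noncomputable def signedFormula {n : ℕ} (p : Prop) (θ : Language.graph.BoundedFormula Empty n) :
    Language.graph.BoundedFormula Empty n :=
  if p then θ else θ.not

lemma isQF_signedFormula {n : ℕ} {p : Prop} {θ : Language.graph.BoundedFormula Empty n}
    (h : θ.IsQF) : (signedFormula p θ).IsQF := by
  unfold signedFormula
  split_ifs
  exacts [h, h.not]

lemma realize_signedFormula {n : ℕ} {p : Prop} {θ : Language.graph.BoundedFormula Empty n}
    {V : Type} [Language.graph.Structure V] {v : Empty → V} {a : Fin n → V} :
    (signedFormula p θ).Realize v a ↔ (p ↔ θ.Realize v a) := by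
  unfold signedFormula
  split_ifs with h <;> simp [h]

/-- The quantifier-free formula describing an `n`-tuple of vertices whose equalities and
adjacencies are given by `D`. -/
noncomputable def diagramFormula {n : ℕ} (D : Fin n × Fin n → Prop × Prop) :
    Language.graph.BoundedFormula Empty n :=
  BoundedFormula.iInf fun ij : Fin n × Fin n =>
    signedFormula (D ij).1
        ((Term.var (Sum.inr ij.1)).bdEqual (Term.var (Sum.inr ij.2))) ⊓
      signedFormula (D ij).2
        (adj.boundedFormula₂ (Term.var (Sum.inr ij.1)) (Term.var (Sum.inr ij.2)))

/-- The equalities and adjacencies within a tuple of vertices. -/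
def diagram {V : Type} (G : SimpleGraph V) {n : ℕ} (a : Fin n → V) :
    Fin n × Fin n → Prop × Prop :=
  fun ij => (a ij.1 = a ij.2, G.Adj (a ij.1) (a ij.2))

lemma isQF_diagramFormula {n : ℕ} (D : Fin n × Fin n → Prop × Prop) :
    (diagramFormula D).IsQF :=
  BoundedFormula.IsQF.iInf fun _ =>
    (isQF_signedFormula (BoundedFormula.IsAtomic.equal _ _).isQF).inf
      (isQF_signedFormula (BoundedFormula.IsAtomic.rel _ _).isQF)

lemma realize_diagramFormula {n : ℕ} (D : Fin n × Fin n → Prop × Prop) {V : Type}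
    (G : SimpleGraph V) (v : Empty → V) (a : Fin n → V) :
    @BoundedFormula.Realize Language.graph V G.structure _ _ (diagramFormula D) v a ↔
      D = diagram G a := by
  let := G.structure
  simp only [diagramFormula, BoundedFormula.realize_iInf, BoundedFormula.realize_inf,
    realize_signedFormula, BoundedFormula.realize_bdEqual, BoundedFormula.realize_rel₂,
    funext_iff, Prod.ext_iff, eq_iff_iff]
  rfl

/-- A tuple that realizes the diagram of an enumeration of `G` yields an embedding of `G`. -/
noncomputable def embeddingOfDiagram {V W : Type} {G : SimpleGraph V} {H : SimpleGraph W} {n : ℕ}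
    {a : Fin n → V} {b : Fin n → W} (ha : Function.Surjective a)
    (h : diagram G a = diagram H b) : G ↪g H where
  toFun v := b (Function.surjInv ha v)
  inj' v w hvw := by
    have := congrArg Prod.fst (congrFun h (Function.surjInv ha v, Function.surjInv ha w))
    simp only [diagram, Function.surjInv_eq] at this
    exact this.mpr hvw
  map_rel_iff' {v w} := by
    have := congrArg Prod.snd (congrFun h (Function.surjInv ha v, Function.surjInv ha w))
    simp only [diagram, Function.surjInv_eq] at this
    exact this.symm.to_iff

end Diagram

lemma Dclass.of_embedding {V W : Type} [Finite W] {G : SimpleGraph V} {H : SimpleGraph W} {d : ℕ}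
    (h : Dclass d W H) (e : G ↪g H) : Dclass d V G :=
  h.imp (fun h => SimpleGraph.ncard_neighborSet_le_of_embedding e h)
    (fun h => SimpleGraph.ncard_neighborSet_le_of_embedding (e.twist true) h)

lemma exists_surjective_fin {α : Type} [Finite α] [Nonempty α] {N : ℕ} (h : Nat.card α ≤ N) :
    ∃ a : Fin N → α, Function.Surjective a := by
  have := Fintype.ofFinite α
  rw [Nat.card_eq_fintype_card] at h
  obtain ⟨f⟩ := Function.Embedding.nonempty_of_card_le (α := α) (β := Fin N) (by simpa using h)
  exact ⟨Function.invFun f, Function.invFun_surjective f.injective⟩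

/-- Every model of `φ` in `D_d` has an induced submodel of bounded size. -/
lemma exists_bounded_submodel_Dclass (d : ℕ) (φ : Language.graph.Sentence)
    (hpres : ∀ (V W : Type) [Finite V] [Finite W] (G : SimpleGraph V) (H : SimpleGraph W),
      Dclass d V G → Dclass d W H → (G ↪g H) → GSat G φ → GSat H φ) :
    ∃ N, ∀ (V : Type) [Finite V] (G : SimpleGraph V), Dclass d V G → GSat G φ →
      ∃ S : Set V, S.ncard ≤ N ∧ GSat (G.induce S) φ := by
  obtain ⟨N₁, h₁⟩ := SimpleGraph.exists_bounded_submodel d φ false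
    fun V W _ _ G H hG hH e => hpres V W G H (Or.inl hG) (Or.inl hH) e
  obtain ⟨N₂, h₂⟩ := SimpleGraph.exists_bounded_submodel d φ true
    fun V W _ _ G H hG hH e => hpres V W Gᶜ Hᶜ (Or.inr (by rwa [_root_.compl_compl]))
      (Or.inr (by rwa [_root_.compl_compl])) (e.twist true)
  refine ⟨max N₁ N₂, fun V _ G hG hφ => ?_⟩
  rcases hG with hG | hG
  · obtain ⟨S, hS, hSφ⟩ := h₁ V G hG hφ
    exact ⟨S, hS.trans (le_max_left _ _), hSφ⟩
  · obtain ⟨S, hS, hSφ⟩ := h₂ V Gᶜ hG (by simpa [SimpleGraph.twist] using hφ)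
    refine ⟨S, hS.trans (le_max_right _ _), ?_⟩
    have heq : (Gᶜ.induce S).twist true = G.induce S := by
      ext x y
      simp only [SimpleGraph.twist, cond_true, SimpleGraph.compl_adj, SimpleGraph.comap_adj,
        Function.Embedding.subtype_apply, ne_eq, Subtype.ext_iff]
      have : G.Adj x y → (x : V) ≠ y := fun h => h.ne
      tauto
    rwa [heq] at hSφ

/-- Extension preservation holds over `D_d`: every sentence preserved by embeddings over `D_d`
is equivalent over `D_d` to an existential sentence. -/
theorem stmt_14 (d : ℕ) (φ : Language.graph.Sentence)
    (hpres : ∀ (V W : Type) [Fintype V] [Fintype W] (G : SimpleGraph V) (H : SimpleGraph W),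
      Dclass d V G → Dclass d W H → (G ↪g H) → GSat G φ → GSat H φ) :
    ∃ ψ : Language.graph.Sentence, IsExistentialSentence ψ ∧
      ∀ (V : Type) [Fintype V] (G : SimpleGraph V),
        Dclass d V G → (GSat G φ ↔ GSat G ψ) := by
  have hpres' : ∀ (V W : Type) [Finite V] [Finite W] (G : SimpleGraph V) (H : SimpleGraph W),
      Dclass d V G → Dclass d W H → (G ↪g H) → GSat G φ → GSat H φ := fun V W _ _ G H hG hH e =>
    let := Fintype.ofFinite V
    let := Fintype.ofFinite W
    hpres V W G H hG hH e
  obtain ⟨N, hN⟩ := exists_bounded_submodel_Dclass d φ hpres'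
  by_cases hempty : GSat (⊥ : SimpleGraph Empty) φ
  · refine ⟨⊤, ⟨0, ⊤, BoundedFormula.IsQF.top, rfl⟩, fun V _ G hG => ?_⟩
    refine iff_of_true (hpres' _ _ _ _ (Or.inl fun v => v.elim) hG
      ⟨Function.Embedding.ofIsEmpty, fun {v} => v.elim⟩ hempty) ?_
    exact id
  · let 𝓓 : Type := {D : Fin N × Fin N → Prop × Prop // ∃ (V : Type) (_ : Finite V)
      (G : SimpleGraph V) (a : Fin N → V), Dclass d V G ∧ Function.Surjective a ∧ GSat G φ ∧
        D = diagram G a}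
    let θ : Language.graph.BoundedFormula Empty N :=
      BoundedFormula.iSup fun D : 𝓓 => diagramFormula D.1
    refine ⟨θ.exs, ⟨N, θ, BoundedFormula.IsQF.iSup fun D => isQF_diagramFormula _, rfl⟩,
      fun V _ G hG => ?_⟩
    have hθ : GSat G θ.exs ↔ ∃ (b : Fin N → V) (D : 𝓓), D.1 = diagram G b := by
      let := G.structure
      exact BoundedFormula.realize_exs.trans <| exists_congr fun b =>
        BoundedFormula.realize_iSup.trans <| exists_congr fun D => realize_diagramFormula _ _ _ _
    rw [hθ]
    constructor
    · intro hφ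
      obtain ⟨S, hS, hSφ⟩ := hN V G hG hφ
      have hSD : Dclass d S (G.induce S) := hG.of_embedding (SimpleGraph.Embedding.induce S)
      have : Nonempty S := by
        by_contra hne
        have := not_nonempty_iff.1 hne
        exact hempty (hpres' _ _ _ _ hSD (Or.inl fun v => v.elim)
          ⟨Function.Embedding.ofIsEmpty, fun {v} => isEmptyElim v⟩ hSφ)
      obtain ⟨a, ha⟩ := exists_surjective_fin (α := S) (N := N) (by rwa [Nat.card_coe_set_eq])
      refine ⟨fun i => a i, ⟨_, S, inferInstance, _, a, hSD, ha, hSφ, rfl⟩, ?_⟩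
      funext ij
      simp only [diagram, SimpleGraph.comap_adj, Function.Embedding.subtype_apply,
        Subtype.ext_iff]
    · rintro ⟨b, ⟨D, V', _, G', a, hG', ha, hφ', rfl⟩, hD⟩
      exact hpres' _ _ _ _ hG' hG (embeddingOfDiagram ha hD) hφ'
end
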